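/- Cavity estimate, first part: ∫_0^{ε₀} | E[log⟨Σ_{σ∈S} P0(σ)·exp(σ̄·z(x) + σ̄²·s(x))⟩_{n,ε}] − ( ε·E_{P0}[X²]·(λ/2)·E[Q] + (1−ε)·E[log Σ_{σ∈S} P0(σ)·exp(√(λQ)·σ·Z_0 + λQ·σ·X′ − (λσ²/2)·Q)] ) | dε → 0 as n → ∞, where Z_0 ~ N(0,1) is independent of all other random variables. -/

import Mathlib

open MeasureTheory ProbabilityTheory Filter Finset Real

noncomputable section

/-- The standard Gaussian measure on `ℝ`. -/
def stdGauss : Measure ℝ := gaussianReal 0 1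

/-- The Bernoulli(ε) measure on `Bool`. -/
def bern (ε : ℝ) : Measure Bool :=
  ENNReal.ofReal ε • Measure.dirac true + ENNReal.ofReal (1 - ε) • Measure.dirac false

instance (ε : ℝ) : IsFiniteMeasure (bern ε) := by
  constructor
  rw [bern, Measure.add_apply, Measure.smul_apply, Measure.smul_apply, smul_eq_mul,
    smul_eq_mul, measure_univ, measure_univ, mul_one, mul_one]
  exact ENNReal.add_lt_top.2 ⟨ENNReal.ofReal_lt_top, ENNReal.ofReal_lt_top⟩

/-- The set of pairs `(i, j)` with `i < j`. -/
def pairs (n : ℕ) : Finset (Fin n × Fin n) :=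
  Finset.univ.filter fun p => p.1 < p.2

/-- The ambient sample space of the cavity computation:
`(X, Z, L, Z″, Z̃)` where `X : Fin (n+1) → ℝ` is the signal, `Z` the Gaussian noise,
`L` the Bernoulli revelation variables, and `Z″, Z̃` the auxiliary Gaussians used in `y`. -/
abbrev CavΩ (n : ℕ) :=
  (Fin (n + 1) → ℝ) × ((Fin (n + 1) × Fin (n + 1)) → ℝ) × (Fin (n + 1) → Bool) ×
    (Fin (n + 1) → ℝ) × ((Fin (n + 1) × Fin (n + 1)) → ℝ)

/-- The law of `(X, Z, L, Z″, Z̃)`: all coordinates independent, `X_i` i.i.d. `P0`,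
`Z, Z″, Z̃` i.i.d. standard Gaussian, `L_i` i.i.d. Bernoulli(ε). -/
def cavMeas (P0 : Measure ℝ) [IsProbabilityMeasure P0] (n : ℕ) (ε : ℝ) :
    Measure (CavΩ n) :=
  (Measure.pi fun _ : Fin (n + 1) => P0).prod
    ((Measure.pi fun _ : Fin (n + 1) × Fin (n + 1) => stdGauss).prod
      ((Measure.pi fun _ : Fin (n + 1) => bern ε).prod
        ((Measure.pi fun _ : Fin (n + 1) => stdGauss).prod
          (Measure.pi fun _ : Fin (n + 1) × Fin (n + 1) => stdGauss))))

/-- `x̄_i = L_i X_i + (1 − L_i) x_i`. -/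
def xbar (n : ℕ) (ω : CavΩ n) (x : Fin n → ℝ) : Fin n → ℝ :=
  fun i => if ω.2.2.1 i.castSucc then ω.1 i.castSucc else x i

/-- `σ̄ = (1 − L_{n+1}) σ + L_{n+1} X′`. -/
def sigbar (n : ℕ) (ω : CavΩ n) (σ : ℝ) : ℝ :=
  if ω.2.2.1 (Fin.last n) then ω.1 (Fin.last n) else σ

/-- The cavity Hamiltonian `H′_n(x)`. -/
def Hcav (n : ℕ) (lam : ℝ) (ω : CavΩ n) (x : Fin n → ℝ) : ℝ :=
  ∑ p ∈ pairs n,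
    (Real.sqrt (lam / (n + 1)) * ω.2.1 (p.1.castSucc, p.2.castSucc) * x p.1 * x p.2
      + lam / (n + 1) * ω.1 p.1.castSucc * ω.1 p.2.castSucc * x p.1 * x p.2
      - lam / (2 * (n + 1)) * (x p.1) ^ 2 * (x p.2) ^ 2)

/-- The configurations `x ∈ Sⁿ`. -/
def confs (S : Finset ℝ) (n : ℕ) : Finset (Fin n → ℝ) :=
  Fintype.piFinset fun _ => S

/-- The weight `P0⊗n(x) = Π_i P0({x_i})`. -/
def weight (P0 : Measure ℝ) (n : ℕ) (x : Fin n → ℝ) : ℝ :=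
  ∏ i, (P0 {x i}).toReal

/-- The Gibbs average
`⟨f(x)⟩_{n,ε} = Σ_x P0⊗n(x) f(x̄) exp(H′_n(x̄)) / Σ_x P0⊗n(x) exp(H′_n(x̄))`. -/
def gibbs (P0 : Measure ℝ) (S : Finset ℝ) (n : ℕ) (lam : ℝ) (ω : CavΩ n)
    (f : (Fin n → ℝ) → ℝ) : ℝ :=
  (∑ x ∈ confs S n, weight P0 n x * f (xbar n ω x) * Real.exp (Hcav n lam ω (xbar n ω x)))
    / (∑ x ∈ confs S n, weight P0 n x * Real.exp (Hcav n lam ω (xbar n ω x)))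

/-- The normalized dot product `u · v = (1/n) Σ_i u_i v_i`. -/
def ndot (n : ℕ) (u v : Fin n → ℝ) : ℝ := (1 / n : ℝ) * ∑ i, u i * v i

/-- The cavity field `z(x) = √(λ/n) Σ_i x_i Z′_i + λ (x·X) X′`. -/
def zfield (n : ℕ) (lam : ℝ) (ω : CavΩ n) (x : Fin n → ℝ) : ℝ :=
  Real.sqrt (lam / n) * ∑ i : Fin n, x i * ω.2.1 (i.castSucc, Fin.last n)
    + lam * ndot n x (fun i => ω.1 i.castSucc) * ω.1 (Fin.last n)

/-- The cavity field `s(x) = −(λ/2) (x·x)`. -/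
def sfield (n : ℕ) (lam : ℝ) (x : Fin n → ℝ) : ℝ := -(lam / 2) * ndot n x x

/-- `b_i = ⟨x_i⟩_{n,ε}`. -/
def bcoef (P0 : Measure ℝ) (S : Finset ℝ) (n : ℕ) (lam : ℝ) (ω : CavΩ n)
    (i : Fin n) : ℝ :=
  gibbs P0 S n lam ω (fun x => x i)

/-- `Q = (1/n) Σ_i b_i²`. -/
def Qoverlap (P0 : Measure ℝ) (S : Finset ℝ) (n : ℕ) (lam : ℝ) (ω : CavΩ n) : ℝ :=
  (1 / n : ℝ) * ∑ i : Fin n, (bcoef P0 S n lam ω i) ^ 2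

/-- The cavity field
`y(x) = (√λ/(√2 n)) Σ_i Z″_i x_i² + (√λ/n) Σ_{i<j} x_i x_j Z̃_{ij}
  + (λ/2)((x·X)² − (1/2)(x·x)²)`. -/
def yfield (n : ℕ) (lam : ℝ) (ω : CavΩ n) (x : Fin n → ℝ) : ℝ :=
  Real.sqrt lam / (Real.sqrt 2 * n) * ∑ i : Fin n, ω.2.2.2.1 i.castSucc * (x i) ^ 2
    + Real.sqrt lam / n *
        ∑ p ∈ pairs n, x p.1 * x p.2 * ω.2.2.2.2 (p.1.castSucc, p.2.castSucc)
    + lam / 2 * ((ndot n x (fun i => ω.1 i.castSucc)) ^ 2 - 1 / 2 * (ndot n x x) ^ 2)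

/-- The function `x ↦ Σ_{σ∈S} P0(σ) exp(σ̄ z(x) + σ̄² s(x))`. -/
def fzs (P0 : Measure ℝ) (S : Finset ℝ) (n : ℕ) (lam : ℝ) (ω : CavΩ n)
    (x : Fin n → ℝ) : ℝ :=
  ∑ σ ∈ S, (P0 {σ}).toReal *
    Real.exp (sigbar n ω σ * zfield n lam ω x + (sigbar n ω σ) ^ 2 * sfield n lam x)

/-- `U = ⟨Σ_{σ∈S} P0(σ) exp(σ̄ z(x) + σ̄² s(x))⟩_{n,ε}`. -/
def Ucav (P0 : Measure ℝ) (S : Finset ℝ) (n : ℕ) (lam : ℝ) (ω : CavΩ n) : ℝ :=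
  gibbs P0 S n lam ω (fzs P0 S n lam ω)

/-- `V = Σ_{σ∈S} P0(σ) exp(σ̄ √(λ/n) Σ_i b_i Z′_i + λQ X′ σ̄ − (λQ/2) σ̄²)`. -/
def Vcav (P0 : Measure ℝ) (S : Finset ℝ) (n : ℕ) (lam : ℝ) (ω : CavΩ n) : ℝ :=
  ∑ σ ∈ S, (P0 {σ}).toReal *
    Real.exp (sigbar n ω σ * Real.sqrt (lam / n) *
        (∑ i : Fin n, bcoef P0 S n lam ω i * ω.2.1 (i.castSucc, Fin.last n))
      + lam * Qoverlap P0 S n lam ω * ω.1 (Fin.last n) * sigbar n ω σ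
      - lam * Qoverlap P0 S n lam ω / 2 * (sigbar n ω σ) ^ 2)

/-- Reveal the coordinates of `X` selected by `L`, and keep those of `x` elsewhere. -/
def mix {n : ℕ} (L : Fin n → Bool) (X x : Fin n → ℝ) : Fin n → ℝ :=
  fun i => if L i then X i else x i

lemma mix_mix {n : ℕ} (L : Fin n → Bool) (X x y : Fin n → ℝ) :
    mix L (mix L X x) y = mix L X y := by
  funext i
  simp only [mix]
  split_ifs <;> rfl

lemma mix_mem_confs {S : Finset ℝ} {n : ℕ} (L : Fin n → Bool) {X x : Fin n → ℝ}
    (hX : X ∈ confs S n) (hx : x ∈ confs S n) : mix L X x ∈ confs S n := by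
  simp only [confs, Fintype.mem_piFinset, mix] at *
  intro i
  split_ifs
  · exact hX i
  · exact hx i

lemma weight_nonneg (P0 : Measure ℝ) {n : ℕ} (x : Fin n → ℝ) : 0 ≤ weight P0 n x :=
  Finset.prod_nonneg fun _ _ => ENNReal.toReal_nonneg

lemma sum_weight {P0 : Measure ℝ} {S : Finset ℝ} (hP : ∑ s ∈ S, (P0 {s}).toReal = 1) (n : ℕ) :
    ∑ x ∈ confs S n, weight P0 n x = 1 := by
  have := Finset.prod_univ_sum (fun _ : Fin n => S) (fun _ s => (P0 {s}).toReal)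
  simp only [hP, Finset.prod_const_one] at this
  exact this.symm

/-- Two independent samples from the product prior have, after mixing, the law of one sample. -/
lemma sum_sum_weight_mix {P0 : Measure ℝ} {S : Finset ℝ}
    (hP : ∑ s ∈ S, (P0 {s}).toReal = 1) {n : ℕ} (L : Fin n → Bool)
    (F : (Fin n → ℝ) → ℝ) :
    ∑ X ∈ confs S n, ∑ x ∈ confs S n, weight P0 n X * weight P0 n x * F (mix L X x)
      = ∑ X ∈ confs S n, weight P0 n X * F X := by
  have h1 : ∀ X x : Fin n → ℝ, weight P0 n (mix L X x) * weight P0 n (mix L x X)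
      = weight P0 n X * weight P0 n x := by
    intro X x
    simp only [weight, ← Finset.prod_mul_distrib]
    refine Finset.prod_congr rfl fun i _ => ?_
    simp only [mix]
    split_ifs
    · rfl
    · ring
  have h2 : ∀ X x : Fin n → ℝ, mix L (mix L X x) (mix L x X) = X := by
    intro X x
    funext i
    simp only [mix]
    split_ifs <;> rfl
  have h3 : ∑ p ∈ confs S n ×ˢ confs S n, weight P0 n p.1 * weight P0 n p.2 * F (mix L p.1 p.2)
      = ∑ p ∈ confs S n ×ˢ confs S n, weight P0 n p.1 * weight P0 n p.2 * F p.1 := by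
    refine Finset.sum_nbij' (fun p => (mix L p.1 p.2, mix L p.2 p.1))
      (fun p => (mix L p.1 p.2, mix L p.2 p.1)) ?_ ?_ ?_ ?_ ?_
    · intro p hp
      rw [Finset.mem_product] at hp ⊢
      exact ⟨mix_mem_confs L hp.1 hp.2, mix_mem_confs L hp.2 hp.1⟩
    · intro p hp
      rw [Finset.mem_product] at hp ⊢
      exact ⟨mix_mem_confs L hp.1 hp.2, mix_mem_confs L hp.2 hp.1⟩
    · intro p _
      simp only [h2]
    · intro p _
      simp only [h2]
    · intro p _
      simp only [h1]
  rw [Finset.sum_product, Finset.sum_product] at h3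
  rw [h3]
  refine Finset.sum_congr rfl fun X _ => ?_
  dsimp only
  rw [← Finset.sum_mul, ← Finset.mul_sum, sum_weight hP, mul_one]

/-- Normalizing constant of the posterior given the coordinates of `X` revealed by `L`. -/
def gden (P0 : Measure ℝ) (S : Finset ℝ) {n : ℕ} (e : (Fin n → ℝ) → ℝ) (L : Fin n → Bool)
    (X : Fin n → ℝ) : ℝ :=
  ∑ x ∈ confs S n, weight P0 n x * e (mix L X x)

/-- Posterior mean of `f`, for the likelihood `e` and the coordinates of `X` revealed by `L`. -/
def gavg (P0 : Measure ℝ) (S : Finset ℝ) {n : ℕ} (e : (Fin n → ℝ) → ℝ) (L : Fin n → Bool)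
    (X : Fin n → ℝ) (f : (Fin n → ℝ) → ℝ) : ℝ :=
  (∑ x ∈ confs S n, weight P0 n x * f (mix L X x) * e (mix L X x)) / gden P0 S e L X

/-- Posterior probability of the configuration `x`. -/
def gwt (P0 : Measure ℝ) (S : Finset ℝ) {n : ℕ} (e : (Fin n → ℝ) → ℝ) (L : Fin n → Bool)
    (X x : Fin n → ℝ) : ℝ :=
  weight P0 n x * e (mix L X x) / gden P0 S e L X

/-- Posterior covariance of the coordinates `i` and `j`. -/
def gcov (P0 : Measure ℝ) (S : Finset ℝ) {n : ℕ} (e : (Fin n → ℝ) → ℝ) (L : Fin n → Bool)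
    (X : Fin n → ℝ) (i j : Fin n) : ℝ :=
  gavg P0 S e L X (fun x => x i * x j)
    - gavg P0 S e L X (fun x => x i) * gavg P0 S e L X (fun x => x j)

lemma gavg_mix (P0 : Measure ℝ) (S : Finset ℝ) {n : ℕ} (e : (Fin n → ℝ) → ℝ)
    (L : Fin n → Bool) (X x : Fin n → ℝ) (f : (Fin n → ℝ) → ℝ) :
    gavg P0 S e L (mix L X x) f = gavg P0 S e L X f := by
  simp only [gavg, gden, mix_mix]

lemma gcov_mix (P0 : Measure ℝ) (S : Finset ℝ) {n : ℕ} (e : (Fin n → ℝ) → ℝ)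
    (L : Fin n → Bool) (X x : Fin n → ℝ) (i j : Fin n) :
    gcov P0 S e L (mix L X x) i j = gcov P0 S e L X i j := by
  simp only [gcov, gavg_mix]

section Posterior

variable {P0 : Measure ℝ} {S : Finset ℝ} {n : ℕ} {e : (Fin n → ℝ) → ℝ}

lemma gden_pos (hP : ∑ s ∈ S, (P0 {s}).toReal = 1) (he : ∀ x, 0 < e x) (L : Fin n → Bool)
    (X : Fin n → ℝ) : 0 < gden P0 S e L X := by
  refine lt_of_le_of_ne (Finset.sum_nonneg fun x _ => mul_nonneg (weight_nonneg P0 x) (he _).le) ?_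
  intro h
  have h0 := (Finset.sum_eq_zero_iff_of_nonneg
    (fun x _ => mul_nonneg (weight_nonneg P0 x) (he (mix L X x)).le)).1 h.symm
  have h1 : ∑ x ∈ confs S n, weight P0 n x = 0 := Finset.sum_eq_zero fun x hx =>
    (mul_eq_zero.1 (h0 x hx)).resolve_right (he _).ne'
  rw [sum_weight hP] at h1
  exact one_ne_zero h1

lemma gwt_nonneg (he : ∀ x, 0 < e x) (L : Fin n → Bool) (X x : Fin n → ℝ) :
    0 ≤ gwt P0 S e L X x :=
  div_nonneg (mul_nonneg (weight_nonneg P0 x) (he _).le)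
    (Finset.sum_nonneg fun x _ => mul_nonneg (weight_nonneg P0 x) (he _).le)

lemma sum_gwt (hP : ∑ s ∈ S, (P0 {s}).toReal = 1) (he : ∀ x, 0 < e x) (L : Fin n → Bool)
    (X : Fin n → ℝ) : ∑ x ∈ confs S n, gwt P0 S e L X x = 1 := by
  simp only [gwt, ← Finset.sum_div]
  exact div_self (gden_pos hP he L X).ne'

lemma gavg_eq_sum (L : Fin n → Bool) (X : Fin n → ℝ) (f : (Fin n → ℝ) → ℝ) :
    gavg P0 S e L X f = ∑ x ∈ confs S n, gwt P0 S e L X x * f (mix L X x) := by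
  simp only [gavg, gwt, Finset.sum_div]
  exact Finset.sum_congr rfl fun x _ => by ring

lemma abs_gavg_le (hP : ∑ s ∈ S, (P0 {s}).toReal = 1) (he : ∀ x, 0 < e x) (L : Fin n → Bool)
    {X : Fin n → ℝ} (hX : X ∈ confs S n) {f : (Fin n → ℝ) → ℝ} {B : ℝ}
    (hf : ∀ x ∈ confs S n, |f x| ≤ B) : |gavg P0 S e L X f| ≤ B := by
  rw [gavg_eq_sum]
  calc |∑ x ∈ confs S n, gwt P0 S e L X x * f (mix L X x)|
      ≤ ∑ x ∈ confs S n, gwt P0 S e L X x * B := by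
        refine (Finset.abs_sum_le_sum_abs _ _).trans (Finset.sum_le_sum fun x hx => ?_)
        rw [abs_mul, abs_of_nonneg (gwt_nonneg he L X x)]
        exact mul_le_mul_of_nonneg_left (hf _ (mix_mem_confs L hX hx)) (gwt_nonneg he L X x)
    _ = B := by rw [← Finset.sum_mul, sum_gwt hP he, one_mul]

/-- The posterior mean is the conditional expectation given the revealed coordinates. -/
lemma sum_gavg_mul (hP : ∑ s ∈ S, (P0 {s}).toReal = 1) (he : ∀ x, 0 < e x)
    (L : Fin n → Bool) (f g : (Fin n → ℝ) → ℝ) (hg : ∀ X x, g (mix L X x) = g X) :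
    ∑ X ∈ confs S n, weight P0 n X * e X * (gavg P0 S e L X f * g X)
      = ∑ X ∈ confs S n, weight P0 n X * e X * (f X * g X) := by
  have h1 := sum_sum_weight_mix hP L (fun X => e X * (gavg P0 S e L X f * g X))
  have h2 := sum_sum_weight_mix hP L (fun X => e X * (f X * g X))
  have e1 : ∀ F : (Fin n → ℝ) → ℝ, ∑ X ∈ confs S n, weight P0 n X * e X * F X
      = ∑ X ∈ confs S n, weight P0 n X * (e X * F X) :=
    fun F => Finset.sum_congr rfl fun X _ => by ring
  rw [e1 (fun X => gavg P0 S e L X f * g X), e1 (fun X => f X * g X), ← h1, ← h2]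
  refine Finset.sum_congr rfl fun X _ => ?_
  simp only [gavg_mix, hg]
  have h3 : gavg P0 S e L X f * gden P0 S e L X
      = ∑ x ∈ confs S n, weight P0 n x * f (mix L X x) * e (mix L X x) :=
    div_mul_cancel₀ _ (gden_pos hP he L X).ne'
  calc ∑ x ∈ confs S n, weight P0 n X * weight P0 n x *
        (e (mix L X x) * (gavg P0 S e L X f * g X))
      = weight P0 n X * g X * (gavg P0 S e L X f * gden P0 S e L X) := by
        rw [gden, Finset.mul_sum, Finset.mul_sum]
        exact Finset.sum_congr rfl fun x _ => by ring
    _ = _ := by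
        rw [h3, Finset.mul_sum]
        exact Finset.sum_congr rfl fun x _ => by ring

lemma mix_update_true (L : Fin n → Bool) (j : Fin n) (X x : Fin n → ℝ) :
    mix L (mix (Function.update L j true) X x) = mix L X := by
  funext y i
  simp only [mix]
  by_cases hL : L i = true
  · have : Function.update L j true i = true := by
      by_cases hij : i = j
      · subst hij; simp
      · simpa [Function.update_of_ne hij] using hL
    simp [hL, this]
  · simp [hL]

/-- Revealing one more coordinate increases the second moment of a posterior mean, by at least the
squared posterior covariance with that coordinate. -/
lemma sum_gcov_sq_le (hP : ∑ s ∈ S, (P0 {s}).toReal = 1) (he : ∀ x, 0 < e x) {K : ℝ}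
    (hSK : ∀ x ∈ S, |x| ≤ K) (L : Fin n → Bool) (i j : Fin n) :
    ∑ X ∈ confs S n, weight P0 n X * e X * gcov P0 S e L X i j ^ 2
      ≤ K ^ 2 * (∑ X ∈ confs S n, weight P0 n X * e X *
            gavg P0 S e (Function.update L j true) X (fun x => x i) ^ 2
          - ∑ X ∈ confs S n, weight P0 n X * e X * gavg P0 S e L X (fun x => x i) ^ 2) := by
  set L' := Function.update L j true with hL'
  have hLg : ∀ (f : (Fin n → ℝ) → ℝ) X x, gavg P0 S e L (mix L' X x) f = gavg P0 S e L X f := by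
    intro f X x
    simp only [gavg, gden, hL', mix_update_true]
  have hLc : ∀ X x, gcov P0 S e L (mix L' X x) i j = gcov P0 S e L X i j := by
    intro X x
    simp only [gcov, hLg]
  have hj : ∀ X x : Fin n → ℝ, mix L' X x j = X j := by
    intro X x
    simp [mix, hL']
  set c := fun X => gcov P0 S e L X i j with hc
  set a := fun X => gavg P0 S e L X (fun x => x i) with ha
  set b := fun X => gavg P0 S e L' X (fun x => x i) with hb
  have A1 := sum_gavg_mul hP he L (fun x => x i * x j) c (fun X x => gcov_mix _ _ _ _ _ _ _ _)
  have A2 := sum_gavg_mul hP he L (fun x => x j) (fun X => a X * c X)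
    (fun X x => by simp only [ha, hc, gcov_mix, gavg_mix])
  have A3 := sum_gavg_mul hP he L' (fun x => x i) (fun X => X j * c X)
    (fun X x => by simp only [hc, hLc, hj])
  have A4 := sum_gavg_mul hP he L' (fun x => x i) a (fun X x => by simp only [ha, hLg])
  have A5 := sum_gavg_mul hP he L (fun x => x i) a (fun X x => by simp only [ha, gavg_mix])
  have B1 : ∑ X ∈ confs S n, weight P0 n X * e X * c X ^ 2
      = ∑ X ∈ confs S n, weight P0 n X * e X * (c X * X j * (b X - a X)) := by
    have : ∑ X ∈ confs S n, weight P0 n X * e X * c X ^ 2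
        = ∑ X ∈ confs S n, weight P0 n X * e X * (gavg P0 S e L X (fun x => x i * x j) * c X)
          - ∑ X ∈ confs S n, weight P0 n X * e X *
              (gavg P0 S e L X (fun x => x j) * (a X * c X)) := by
      rw [← Finset.sum_sub_distrib]
      refine Finset.sum_congr rfl fun X _ => ?_
      simp only [hc, ha, gcov]
      ring
    rw [this, A1, A2]
    have A3' : ∑ X ∈ confs S n, weight P0 n X * e X * (X i * X j * c X)
        = ∑ X ∈ confs S n, weight P0 n X * e X * (X i * (X j * c X)) :=
      Finset.sum_congr rfl fun X _ => by ring
    rw [A3', ← A3, ← Finset.sum_sub_distrib]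
    exact Finset.sum_congr rfl fun X _ => by simp only [hb]; ring
  have B2 : ∑ X ∈ confs S n, weight P0 n X * e X * b X ^ 2
      - ∑ X ∈ confs S n, weight P0 n X * e X * a X ^ 2
      = ∑ X ∈ confs S n, weight P0 n X * e X * (b X - a X) ^ 2 := by
    have h1 : ∑ X ∈ confs S n, weight P0 n X * e X * (b X * a X)
        = ∑ X ∈ confs S n, weight P0 n X * e X * (a X * a X) := A4.trans A5.symm
    have h2 : ∑ X ∈ confs S n, weight P0 n X * e X * (b X - a X) ^ 2
        = ∑ X ∈ confs S n, weight P0 n X * e X * b X ^ 2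
          - 2 * ∑ X ∈ confs S n, weight P0 n X * e X * (b X * a X)
          + ∑ X ∈ confs S n, weight P0 n X * e X * a X ^ 2 := by
      rw [Finset.mul_sum, ← Finset.sum_sub_distrib, ← Finset.sum_add_distrib]
      exact Finset.sum_congr rfl fun X _ => by ring
    have h3 : ∑ X ∈ confs S n, weight P0 n X * e X * (a X * a X)
        = ∑ X ∈ confs S n, weight P0 n X * e X * a X ^ 2 :=
      Finset.sum_congr rfl fun X _ => by ring
    rw [h2, h1, h3]
    ring
  have B3 : ∑ X ∈ confs S n, weight P0 n X * e X * (c X * X j * (b X - a X))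
      ≤ 1 / 2 * ∑ X ∈ confs S n, weight P0 n X * e X * c X ^ 2
        + K ^ 2 / 2 * ∑ X ∈ confs S n, weight P0 n X * e X * (b X - a X) ^ 2 := by
    rw [Finset.mul_sum, Finset.mul_sum, ← Finset.sum_add_distrib]
    refine Finset.sum_le_sum fun X hX => ?_
    have hw : 0 ≤ weight P0 n X * e X := mul_nonneg (weight_nonneg P0 X) (he X).le
    have hXj : X j ^ 2 ≤ K ^ 2 := by
      rw [← sq_abs]
      exact pow_le_pow_left₀ (abs_nonneg _) (hSK _ (Fintype.mem_piFinset.1 hX j)) 2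
    have : c X * X j * (b X - a X) ≤ 1 / 2 * c X ^ 2 + K ^ 2 / 2 * (b X - a X) ^ 2 := by
      have := mul_le_mul_of_nonneg_right hXj (sq_nonneg (b X - a X))
      nlinarith [sq_nonneg (c X - X j * (b X - a X))]
    calc _ ≤ _ := mul_le_mul_of_nonneg_left this hw
      _ = _ := by ring
  rw [B2]
  linarith

end Posterior

/-- Probability of the revelation pattern `L` under i.i.d. Bernoulli(`ε`) revelations. -/
def bernWt {n : ℕ} (ε : ℝ) (L : Fin n → Bool) : ℝ := ∏ i, if L i then ε else 1 - ε

lemma bernWt_nonneg {n : ℕ} {ε : ℝ} (h0 : 0 ≤ ε) (h1 : ε ≤ 1) (L : Fin n → Bool) :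
    0 ≤ bernWt ε L := by
  refine Finset.prod_nonneg fun i _ => ?_
  split_ifs <;> linarith

lemma sum_bernWt (n : ℕ) (ε : ℝ) : ∑ L : Fin n → Bool, bernWt ε L = 1 := by
  have := Finset.prod_univ_sum (fun _ : Fin n => (Finset.univ : Finset Bool))
    (fun _ b => if b then ε else 1 - ε)
  simp only [Fintype.sum_bool, Fintype.piFinset_univ] at this
  simp only [bernWt, ← this]
  simp

lemma sum_update_bool {n : ℕ} (j : Fin n) (φ : (Fin n → Bool) → ℝ) :
    ∑ L, (φ (Function.update L j true) + φ (Function.update L j false)) = 2 * ∑ L, φ L := by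
  have hinv : Function.Involutive (fun L : Fin n → Bool => Function.update L j (!(L j))) := by
    intro L
    simp
  have h1 : ∑ L, φ (Function.update L j (!(L j))) = ∑ L, φ L :=
    Fintype.sum_bijective _ hinv.bijective _ _ fun _ => rfl
  have h2 : ∀ L, φ (Function.update L j true) + φ (Function.update L j false)
      = φ L + φ (Function.update L j (!(L j))) := by
    intro L
    have h3 := Function.update_eq_self j L
    rcases hb : L j with _ | _
    · rw [hb] at h3
      rw [h3]
      exact add_comm _ _
    · rw [hb] at h3
      rw [h3]
      rfl
  rw [Finset.sum_congr rfl fun L _ => h2 L, Finset.sum_add_distrib, h1]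
  ring

/-- Russo's formula. -/
lemma hasDerivAt_sum_bernWt {n : ℕ} (f : (Fin n → Bool) → ℝ) (ε : ℝ) :
    HasDerivAt (fun ε => ∑ L, bernWt ε L * f L)
      (∑ j, ∑ L, bernWt ε L *
        (f (Function.update L j true) - f (Function.update L j false))) ε := by
  have h1 : ∀ L : Fin n → Bool, HasDerivAt (fun ε => bernWt ε L * f L)
      ((∑ j, (∏ i ∈ Finset.univ.erase j, if L i then ε else 1 - ε) * (if L j then 1 else -1))
        * f L) ε := by
    intro L
    refine HasDerivAt.mul_const ?_ _
    have := HasDerivAt.fun_finsetProd (u := Finset.univ)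
      (f := fun (i : Fin n) (ε : ℝ) => if L i then ε else 1 - ε)
      (f' := fun i => if L i then 1 else -1) (x := ε) (by
        intro i _
        split_ifs
        · exact hasDerivAt_id ε
        · simpa using (hasDerivAt_id ε).const_sub 1)
    simp only [smul_eq_mul] at this
    exact this
  have h2 := HasDerivAt.fun_sum (u := Finset.univ) fun L _ => h1 L
  refine h2.congr_deriv (Eq.symm ?_)
  simp only [Finset.sum_mul]
  rw [Finset.sum_comm (f := fun L j => (∏ i ∈ Finset.univ.erase j, if L i then ε else 1 - ε)
    * (if L j then (1 : ℝ) else -1) * f L)]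
  refine Finset.sum_congr rfl fun j _ => ?_
  have hE : ∀ (L : Fin n → Bool) (b : Bool),
      (∏ i ∈ Finset.univ.erase j, if Function.update L j b i then ε else 1 - ε)
        = ∏ i ∈ Finset.univ.erase j, if L i then ε else 1 - ε := by
    intro L b
    refine Finset.prod_congr rfl fun i hi => ?_
    rw [Function.update_of_ne (Finset.ne_of_mem_erase hi)]
  have hB : ∀ L : Fin n → Bool, bernWt ε L = (if L j then ε else 1 - ε)
      * ∏ i ∈ Finset.univ.erase j, if L i then ε else 1 - ε :=
    fun L => (Finset.mul_prod_erase _ _ (Finset.mem_univ j)).symm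
  refine mul_left_cancel₀ (two_ne_zero : (2 : ℝ) ≠ 0) ?_
  rw [← sum_update_bool j, ← sum_update_bool j]
  refine Finset.sum_congr rfl fun L _ => ?_
  simp only [hB, hE, Function.update_self, Function.update_idem]
  simp only [if_true, Bool.false_eq_true, if_false]
  ring

lemma continuous_bernWt {n : ℕ} (L : Fin n → Bool) : Continuous fun ε => bernWt ε L := by
  unfold bernWt
  refine continuous_finsetProd _ fun i _ => ?_
  split_ifs <;> fun_prop

/-- Pinning: if revealing the coordinate `j` increases `q` by at least a multiple of `c j`, then the
`c j` are small on average over the revelation probability. -/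
lemma pinning {n : ℕ} (c : Fin n → (Fin n → Bool) → ℝ) (q : (Fin n → Bool) → ℝ) {C : ℝ}
    (hC : 0 < C) (hc : ∀ j L, 0 ≤ c j L)
    (hq : ∀ j L, c j L ≤ C * (q (Function.update L j true) - q L)) {ε : ℝ} (h0 : 0 ≤ ε)
    (h1 : ε ≤ 1) :
    ∑ L, bernWt ε L * ∑ j, c j L ≤ C * ∑ j, ∑ L, bernWt ε L *
        (q (Function.update L j true) - q (Function.update L j false)) := by
  simp only [Finset.mul_sum]
  rw [Finset.sum_comm]
  refine Finset.sum_le_sum fun j _ => Finset.sum_le_sum fun L _ => ?_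
  have hmono : q (Function.update L j false) ≤ q L := by
    have h3 := Function.update_eq_self j L
    rcases hb : L j with _ | _
    · rw [hb] at h3
      rw [h3]
    · rw [hb] at h3
      have h4 := hq j (Function.update L j false)
      rw [Function.update_idem, h3] at h4
      have := (hc j _).trans h4
      have := nonneg_of_mul_nonneg_right this hC
      linarith
  have h5 : c j L ≤ C * (q (Function.update L j true) - q (Function.update L j false)) :=
    (hq j L).trans (mul_le_mul_of_nonneg_left (by linarith) hC.le)
  calc _ ≤ _ := mul_le_mul_of_nonneg_left h5 (bernWt_nonneg h0 h1 L)
    _ = _ := by ring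

section Linear

variable {P0 : Measure ℝ} {S : Finset ℝ} {n : ℕ} {e : (Fin n → ℝ) → ℝ} (L : Fin n → Bool)
  (X : Fin n → ℝ)

lemma gavg_add (f g : (Fin n → ℝ) → ℝ) :
    gavg P0 S e L X (fun x => f x + g x) = gavg P0 S e L X f + gavg P0 S e L X g := by
  simp only [gavg_eq_sum, ← Finset.sum_add_distrib, mul_add]

lemma gavg_sub (f g : (Fin n → ℝ) → ℝ) :
    gavg P0 S e L X (fun x => f x - g x) = gavg P0 S e L X f - gavg P0 S e L X g := by
  simp only [gavg_eq_sum, ← Finset.sum_sub_distrib, mul_sub]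

lemma gavg_const_mul (a : ℝ) (f : (Fin n → ℝ) → ℝ) :
    gavg P0 S e L X (fun x => a * f x) = a * gavg P0 S e L X f := by
  simp only [gavg_eq_sum, Finset.mul_sum]
  exact Finset.sum_congr rfl fun x _ => by ring

lemma gavg_sum {ι : Type*} (s : Finset ι) (f : ι → (Fin n → ℝ) → ℝ) :
    gavg P0 S e L X (fun x => ∑ i ∈ s, f i x) = ∑ i ∈ s, gavg P0 S e L X (f i) := by
  simp only [gavg_eq_sum, Finset.mul_sum]
  exact Finset.sum_comm

lemma gavg_const (hP : ∑ s ∈ S, (P0 {s}).toReal = 1) (he : ∀ x, 0 < e x) (a : ℝ) :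
    gavg P0 S e L X (fun _ => a) = a := by
  rw [gavg_eq_sum, ← Finset.sum_mul, sum_gwt hP he, one_mul]

lemma gavg_mono (he : ∀ x, 0 < e x) {f g : (Fin n → ℝ) → ℝ} (h : ∀ x, f x ≤ g x) :
    gavg P0 S e L X f ≤ gavg P0 S e L X g := by
  simp only [gavg_eq_sum]
  exact Finset.sum_le_sum fun x _ => mul_le_mul_of_nonneg_left (h _) (gwt_nonneg he L X x)

end Linear

/-- The vector of posterior means. -/
def gmean (P0 : Measure ℝ) (S : Finset ℝ) {n : ℕ} (e : (Fin n → ℝ) → ℝ) (L : Fin n → Bool)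
    (X : Fin n → ℝ) : Fin n → ℝ :=
  fun i => gavg P0 S e L X fun x => x i

/-- The normalized squared norm of the posterior mean. -/
def gQ (P0 : Measure ℝ) (S : Finset ℝ) {n : ℕ} (e : (Fin n → ℝ) → ℝ) (L : Fin n → Bool)
    (X : Fin n → ℝ) : ℝ :=
  (1 / n : ℝ) * ∑ i, gmean P0 S e L X i ^ 2

/-- Total first-order fluctuation of the overlaps around `gQ`. -/
def gfluct (P0 : Measure ℝ) (S : Finset ℝ) {n : ℕ} (e : (Fin n → ℝ) → ℝ) (L : Fin n → Bool)
    (X : Fin n → ℝ) : ℝ :=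
  gavg P0 S e L X (fun x => gavg P0 S e L X fun x' => |ndot n x x' - gQ P0 S e L X|)
    + 2 * gavg P0 S e L X (fun x => |ndot n x (gmean P0 S e L X) - gQ P0 S e L X|)
    + 4 * gavg P0 S e L X (fun x => |ndot n x X - gQ P0 S e L X|)

section Concentration

variable {P0 : Measure ℝ} {S : Finset ℝ} {n : ℕ} {e : (Fin n → ℝ) → ℝ}

lemma ndot_mul_ndot (u v x y : Fin n → ℝ) :
    ndot n u v * ndot n x y = ∑ i, ∑ j, (1 / n : ℝ) ^ 2 * ((u i * v i) * (x j * y j)) := by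
  simp only [ndot]
  rw [mul_mul_mul_comm, Finset.sum_mul_sum, ← sq, Finset.mul_sum]
  exact Finset.sum_congr rfl fun i _ => Finset.mul_sum _ _ _

lemma gQ_eq_ndot (L : Fin n → Bool) (X : Fin n → ℝ) :
    gQ P0 S e L X = ndot n (gmean P0 S e L X) (gmean P0 S e L X) := by
  simp only [gQ, ndot, sq]

lemma gQ_mix (L : Fin n → Bool) (X x : Fin n → ℝ) :
    gQ P0 S e L (mix L X x) = gQ P0 S e L X := by
  simp only [gQ, gmean, gavg_mix]

lemma gavg_ndot (L : Fin n → Bool) (X u : Fin n → ℝ) :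
    gavg P0 S e L X (fun x => ndot n x u) = ndot n (gmean P0 S e L X) u := by
  simp only [ndot]
  rw [gavg_const_mul, gavg_sum]
  congr 1
  refine Finset.sum_congr rfl fun i _ => ?_
  simp only [mul_comm _ (u i), gavg_const_mul, gmean]

lemma gavg_sq_ndot_sub (hP : ∑ s ∈ S, (P0 {s}).toReal = 1) (he : ∀ x, 0 < e x)
    (L : Fin n → Bool) (X u : Fin n → ℝ) (q : ℝ) :
    gavg P0 S e L X (fun x => (ndot n x u - q) ^ 2)
      = ∑ i, ∑ j, (1 / n : ℝ) ^ 2 * ((u i * u j) * gavg P0 S e L X (fun x => x i * x j))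
        - 2 * q * ndot n (gmean P0 S e L X) u + q ^ 2 := by
  have h : ∀ x, (ndot n x u - q) ^ 2
      = ∑ i, ∑ j, (1 / n : ℝ) ^ 2 * ((u i * u j) * (x i * x j)) - 2 * q * ndot n x u + q ^ 2 := by
    intro x
    have h1 := ndot_mul_ndot x u x u
    have h2 : ∑ i, ∑ j, (1 / n : ℝ) ^ 2 * ((u i * u j) * (x i * x j))
        = ∑ i, ∑ j, (1 / n : ℝ) ^ 2 * ((x i * u i) * (x j * u j)) :=
      Finset.sum_congr rfl fun i _ => Finset.sum_congr rfl fun j _ => by ring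
    rw [h2, ← h1]
    ring
  simp only [h, gavg_add, gavg_sub, gavg_sum, gavg_const_mul, gavg_const L X hP he, gavg_ndot]

lemma abs_gmean_le (hP : ∑ s ∈ S, (P0 {s}).toReal = 1) (he : ∀ x, 0 < e x) {K : ℝ}
    (hSK : ∀ x ∈ S, |x| ≤ K) (L : Fin n → Bool) {X : Fin n → ℝ} (hX : X ∈ confs S n)
    (i : Fin n) : |gmean P0 S e L X i| ≤ K :=
  abs_gavg_le hP he L hX fun _ hx => hSK _ (Fintype.mem_piFinset.1 hx i)

lemma gQ_sq (L : Fin n → Bool) (X : Fin n → ℝ) :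
    gQ P0 S e L X ^ 2 = ∑ i, ∑ j, (1 / n : ℝ) ^ 2 *
      ((gmean P0 S e L X i * gmean P0 S e L X j) *
        (gmean P0 S e L X i * gmean P0 S e L X j)) := by
  rw [sq, gQ_eq_ndot, ndot_mul_ndot]
  exact Finset.sum_congr rfl fun i _ => Finset.sum_congr rfl fun j _ => by ring

/-- Second moment of the overlap of a sample with the posterior mean. -/
lemma gavg_sq_ndot_gmean_le (hP : ∑ s ∈ S, (P0 {s}).toReal = 1) (he : ∀ x, 0 < e x) {K : ℝ}
    (hSK : ∀ x ∈ S, |x| ≤ K) (L : Fin n → Bool) {X : Fin n → ℝ} (hX : X ∈ confs S n) :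
    gavg P0 S e L X (fun x => (ndot n x (gmean P0 S e L X) - gQ P0 S e L X) ^ 2)
      ≤ 2 * K ^ 2 * ∑ i, ∑ j, (1 / n : ℝ) ^ 2 * |gcov P0 S e L X i j| := by
  rw [gavg_sq_ndot_sub hP he, ← gQ_eq_ndot]
  have : ∀ a q : ℝ, a - 2 * q * q + q ^ 2 = a - q ^ 2 := fun a q => by ring
  rw [this, gQ_sq, ← Finset.sum_sub_distrib, Finset.mul_sum]
  refine Finset.sum_le_sum fun i _ => ?_
  rw [← Finset.sum_sub_distrib, Finset.mul_sum]
  refine Finset.sum_le_sum fun j _ => ?_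
  have hi := abs_gmean_le hP he hSK L hX i
  have hj := abs_gmean_le hP he hSK L hX j
  have hK : 0 ≤ K := (abs_nonneg _).trans hi
  set bi := gmean P0 S e L X i
  set bj := gmean P0 S e L X j
  have h1 : bi * bj * gcov P0 S e L X i j ≤ 2 * K ^ 2 * |gcov P0 S e L X i j| := by
    refine (le_abs_self _).trans ?_
    rw [abs_mul, abs_mul]
    refine mul_le_mul_of_nonneg_right ?_ (abs_nonneg _)
    nlinarith [mul_le_mul hi hj (abs_nonneg _) hK, sq_nonneg K]
  calc _ = (1 / n : ℝ) ^ 2 * (bi * bj * gcov P0 S e L X i j) := by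
        simp only [gcov, bi, bj, gmean]
        ring
    _ ≤ (1 / n : ℝ) ^ 2 * (2 * K ^ 2 * |gcov P0 S e L X i j|) :=
        mul_le_mul_of_nonneg_left h1 (sq_nonneg _)
    _ = _ := by ring

lemma gavg_gavg_sq_ndot (hP : ∑ s ∈ S, (P0 {s}).toReal = 1) (he : ∀ x, 0 < e x)
    (L : Fin n → Bool) (X : Fin n → ℝ) :
    gavg P0 S e L X (fun x => gavg P0 S e L X fun x' => (ndot n x x' - gQ P0 S e L X) ^ 2)
      = ∑ i, ∑ j, (1 / n : ℝ) ^ 2 *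
          (gavg P0 S e L X (fun x => x i * x j) * gavg P0 S e L X (fun x => x i * x j))
        - gQ P0 S e L X ^ 2 := by
  have hcomm : ∀ x x' : Fin n → ℝ, ndot n x x' = ndot n x' x := by
    intro x x'
    simp only [ndot, mul_comm]
  have h1 : ∀ x, gavg P0 S e L X (fun x' => (ndot n x x' - gQ P0 S e L X) ^ 2)
      = ∑ i, ∑ j, (1 / n : ℝ) ^ 2 * (gavg P0 S e L X (fun x => x i * x j) * (x i * x j))
        - 2 * gQ P0 S e L X * ndot n x (gmean P0 S e L X) + gQ P0 S e L X ^ 2 := by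
    intro x
    simp only [hcomm x]
    rw [gavg_sq_ndot_sub hP he, hcomm _ x]
    congr 2
    exact Finset.sum_congr rfl fun i _ => Finset.sum_congr rfl fun j _ => by ring
  simp only [h1]
  simp only [gavg_add, gavg_sub, gavg_sum, gavg_const_mul, gavg_const L X hP he, gavg_ndot]
  rw [← gQ_eq_ndot]
  ring

/-- Second moment of the overlap of two independent samples. -/
lemma gavg_gavg_sq_ndot_le (hP : ∑ s ∈ S, (P0 {s}).toReal = 1) (he : ∀ x, 0 < e x) {K : ℝ}
    (hSK : ∀ x ∈ S, |x| ≤ K) (L : Fin n → Bool) {X : Fin n → ℝ} (hX : X ∈ confs S n) :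
    gavg P0 S e L X (fun x => gavg P0 S e L X fun x' => (ndot n x x' - gQ P0 S e L X) ^ 2)
      ≤ 2 * K ^ 2 * ∑ i, ∑ j, (1 / n : ℝ) ^ 2 * |gcov P0 S e L X i j| := by
  rw [gavg_gavg_sq_ndot hP he, gQ_sq, ← Finset.sum_sub_distrib, Finset.mul_sum]
  refine Finset.sum_le_sum fun i _ => ?_
  rw [← Finset.sum_sub_distrib, Finset.mul_sum]
  refine Finset.sum_le_sum fun j _ => ?_
  have hi := abs_gmean_le hP he hSK L hX i
  have hj := abs_gmean_le hP he hSK L hX j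
  have hK : 0 ≤ K := (abs_nonneg _).trans hi
  have hm : |gavg P0 S e L X (fun x => x i * x j)| ≤ K * K :=
    abs_gavg_le hP he L hX fun x hx => by
      rw [abs_mul]
      exact mul_le_mul (hSK _ (Fintype.mem_piFinset.1 hx i)) (hSK _ (Fintype.mem_piFinset.1 hx j))
        (abs_nonneg _) hK
  have hbb : |gmean P0 S e L X i * gmean P0 S e L X j| ≤ K * K := by
    rw [abs_mul]
    exact mul_le_mul hi hj (abs_nonneg _) hK
  set m := gavg P0 S e L X (fun x => x i * x j) with hm'
  set bb := gmean P0 S e L X i * gmean P0 S e L X j with hbb'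
  have hc : gcov P0 S e L X i j = m - bb := rfl
  have h1 : (m + bb) * (m - bb) ≤ 2 * K ^ 2 * |m - bb| := by
    refine (le_abs_self _).trans ?_
    rw [abs_mul]
    refine mul_le_mul_of_nonneg_right ?_ (abs_nonneg _)
    linarith [abs_add_le m bb]
  rw [hc]
  calc _ = (1 / n : ℝ) ^ 2 * ((m + bb) * (m - bb)) := by ring
    _ ≤ (1 / n : ℝ) ^ 2 * (2 * K ^ 2 * |m - bb|) :=
        mul_le_mul_of_nonneg_left h1 (sq_nonneg _)
    _ = _ := by ring

/-- Nishimori identity for the second moment of the overlap with the signal. -/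
lemma sum_gavg_sq_ndot_signal (hP : ∑ s ∈ S, (P0 {s}).toReal = 1) (he : ∀ x, 0 < e x)
    (L : Fin n → Bool) :
    ∑ X ∈ confs S n, weight P0 n X * e X *
        gavg P0 S e L X (fun x => (ndot n x X - gQ P0 S e L X) ^ 2)
      = ∑ X ∈ confs S n, weight P0 n X * e X *
        gavg P0 S e L X (fun x => gavg P0 S e L X fun x' =>
          (ndot n x x' - gQ P0 S e L X) ^ 2) := by
  simp only [gavg_gavg_sq_ndot hP he, gavg_sq_ndot_sub hP he]
  have h1 : ∀ i j, ∑ X ∈ confs S n, weight P0 n X * e X *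
        (X i * X j * gavg P0 S e L X (fun x => x i * x j))
      = ∑ X ∈ confs S n, weight P0 n X * e X *
        (gavg P0 S e L X (fun x => x i * x j) * gavg P0 S e L X (fun x => x i * x j)) :=
    fun i j => (sum_gavg_mul hP he L (fun x => x i * x j)
      (fun X => gavg P0 S e L X (fun x => x i * x j)) fun X x => gavg_mix _ _ _ _ _ _ _).symm
  have h2 : ∀ i, ∑ X ∈ confs S n, weight P0 n X * e X *
        (X i * (gQ P0 S e L X * gmean P0 S e L X i))
      = ∑ X ∈ confs S n, weight P0 n X * e X *
        (gmean P0 S e L X i * (gQ P0 S e L X * gmean P0 S e L X i)) :=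
    fun i => (sum_gavg_mul hP he L (fun x => x i)
      (fun X => gQ P0 S e L X * gmean P0 S e L X i) fun X x => by
        simp only [gQ_mix, gmean, gavg_mix]).symm
  have h3 : ∀ F : Fin n → Fin n → (Fin n → ℝ) → ℝ,
      ∑ X ∈ confs S n, weight P0 n X * e X * ∑ i, ∑ j, (1 / n : ℝ) ^ 2 * F i j X
        = ∑ i, ∑ j, (1 / n : ℝ) ^ 2 * ∑ X ∈ confs S n, weight P0 n X * e X * F i j X := by
    intro F
    simp only [Finset.mul_sum]
    rw [Finset.sum_comm]
    refine Finset.sum_congr rfl fun i _ => ?_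
    rw [Finset.sum_comm]
    exact Finset.sum_congr rfl fun j _ => Finset.sum_congr rfl fun X _ => by ring
  have h4 : ∀ u : (Fin n → ℝ) → Fin n → ℝ,
      ∑ X ∈ confs S n, weight P0 n X * e X *
          (2 * gQ P0 S e L X * ndot n (gmean P0 S e L X) (u X))
        = 2 * (1 / n : ℝ) * ∑ i, ∑ X ∈ confs S n, weight P0 n X * e X *
          (u X i * (gQ P0 S e L X * gmean P0 S e L X i)) := by
    intro u
    rw [Finset.sum_comm, Finset.mul_sum]
    refine Finset.sum_congr rfl fun X _ => ?_
    simp only [ndot, Finset.mul_sum]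
    exact Finset.sum_congr rfl fun i _ => by ring
  have h5 : ∑ X ∈ confs S n, weight P0 n X * e X *
        (2 * gQ P0 S e L X * ndot n (gmean P0 S e L X) X)
      = ∑ X ∈ confs S n, weight P0 n X * e X *
        (2 * gQ P0 S e L X * gQ P0 S e L X) := by
    rw [h4 fun X => X, Finset.sum_congr rfl fun i _ => h2 i, ← h4 fun X => gmean P0 S e L X]
    simp only [← gQ_eq_ndot]
  simp only [mul_add, mul_sub, Finset.sum_add_distrib, Finset.sum_sub_distrib]
  rw [h3 fun i j X => X i * X j * gavg P0 S e L X (fun x => x i * x j),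
    h3 fun i j X => gavg P0 S e L X (fun x => x i * x j) * gavg P0 S e L X (fun x => x i * x j),
    h5]
  simp only [h1]
  have h6 : ∑ X ∈ confs S n, weight P0 n X * e X * (2 * gQ P0 S e L X * gQ P0 S e L X)
      = 2 * ∑ X ∈ confs S n, weight P0 n X * e X * gQ P0 S e L X ^ 2 := by
    rw [Finset.mul_sum]
    exact Finset.sum_congr rfl fun X _ => by ring
  rw [h6]
  ring

lemma abs_le_half_add {η : ℝ} (hη : 0 < η) (t : ℝ) : |t| ≤ 1 / 2 * η + 1 / (2 * η) * t ^ 2 := by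
  have h : 1 / 2 * η + 1 / (2 * η) * t ^ 2 - |t| = 1 / (2 * η) * (|t| - η) ^ 2 := by
    rw [← sq_abs t]
    field_simp
    ring
  have : 0 ≤ 1 / (2 * η) * (|t| - η) ^ 2 := by positivity
  linarith

lemma gfluct_le (hP : ∑ s ∈ S, (P0 {s}).toReal = 1) (he : ∀ x, 0 < e x) {η : ℝ} (hη : 0 < η)
    (L : Fin n → Bool) (X : Fin n → ℝ) :
    gfluct P0 S e L X ≤ 7 / 2 * η + 1 / (2 * η) *
      (gavg P0 S e L X (fun x => gavg P0 S e L X fun x' => (ndot n x x' - gQ P0 S e L X) ^ 2)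
        + 2 * gavg P0 S e L X
            (fun x => (ndot n x (gmean P0 S e L X) - gQ P0 S e L X) ^ 2)
        + 4 * gavg P0 S e L X (fun x => (ndot n x X - gQ P0 S e L X) ^ 2)) := by
  have h1 : ∀ f : (Fin n → ℝ) → ℝ, gavg P0 S e L X (fun x => |f x|)
      ≤ 1 / 2 * η + 1 / (2 * η) * gavg P0 S e L X fun x => f x ^ 2 := by
    intro f
    refine (gavg_mono L X he fun x => abs_le_half_add hη (f x)).trans_eq ?_
    rw [gavg_add, gavg_const L X hP he, gavg_const_mul]
  have h2 : gavg P0 S e L X (fun x => gavg P0 S e L X fun x' => |ndot n x x' - gQ P0 S e L X|)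
      ≤ 1 / 2 * η + 1 / (2 * η) * gavg P0 S e L X
        (fun x => gavg P0 S e L X fun x' => (ndot n x x' - gQ P0 S e L X) ^ 2) := by
    refine (gavg_mono L X he fun x => h1 fun x' => ndot n x x' - gQ P0 S e L X).trans_eq ?_
    rw [gavg_add, gavg_const L X hP he, gavg_const_mul]
  have h3 := h1 fun x => ndot n x (gmean P0 S e L X) - gQ P0 S e L X
  have h4 := h1 fun x => ndot n x X - gQ P0 S e L X
  rw [gfluct]
  linarith

/-- The overlap fluctuations are controlled by the squared posterior covariances. -/
lemma sum_gfluct_le (hP : ∑ s ∈ S, (P0 {s}).toReal = 1) (he : ∀ x, 0 < e x) {K : ℝ}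
    (hSK : ∀ x ∈ S, |x| ≤ K) {η ζ : ℝ} (hη : 0 < η) (hζ : 0 < ζ) (hn : 0 < n)
    (L : Fin n → Bool) :
    ∑ X ∈ confs S n, weight P0 n X * e X * gfluct P0 S e L X
      ≤ 7 / 2 * (η * ∑ X ∈ confs S n, weight P0 n X * e X
          + K ^ 2 / η * (ζ * ∑ X ∈ confs S n, weight P0 n X * e X
            + 1 / ζ * (1 / n : ℝ) ^ 2 * ∑ i, ∑ j, ∑ X ∈ confs S n,
                weight P0 n X * e X * gcov P0 S e L X i j ^ 2)) := by
  set R := fun X => gavg P0 S e L X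
    (fun x => gavg P0 S e L X fun x' => (ndot n x x' - gQ P0 S e L X) ^ 2) with hR
  set C := fun X => ∑ i, ∑ j, (1 / n : ℝ) ^ 2 * |gcov P0 S e L X i j| with hC
  set C2 := fun X => ∑ i, ∑ j, (1 / n : ℝ) ^ 2 * gcov P0 S e L X i j ^ 2 with hC2
  have hw : ∀ X, 0 ≤ weight P0 n X * e X := fun X => mul_nonneg (weight_nonneg P0 X) (he X).le
  have hn' : (n : ℝ) ≠ 0 := by positivity
  have hCC : ∀ X, C X ≤ 1 / 2 * ζ + 1 / (2 * ζ) * C2 X := by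
    intro X
    have h1 : ∑ _i : Fin n, ∑ _j : Fin n, (1 / n : ℝ) ^ 2 * (1 / 2 * ζ) = 1 / 2 * ζ := by
      simp only [Finset.sum_const, Finset.card_univ, Fintype.card_fin, nsmul_eq_mul]
      field_simp
    rw [← h1]
    simp only [hC, hC2, Finset.mul_sum]
    rw [← Finset.sum_add_distrib]
    refine Finset.sum_le_sum fun i _ => ?_
    rw [← Finset.sum_add_distrib]
    refine Finset.sum_le_sum fun j _ => ?_
    calc _ ≤ _ := mul_le_mul_of_nonneg_left (abs_le_half_add hζ (gcov P0 S e L X i j))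
          (sq_nonneg (1 / n : ℝ))
      _ = _ := by ring
  have hsum : ∑ X ∈ confs S n, weight P0 n X * e X * gfluct P0 S e L X
      ≤ ∑ X ∈ confs S n, weight P0 n X * e X *
        (7 / 2 * η + 1 / (2 * η) * (7 * (2 * K ^ 2 * C X))) := by
    calc ∑ X ∈ confs S n, weight P0 n X * e X * gfluct P0 S e L X
        ≤ ∑ X ∈ confs S n, weight P0 n X * e X * (7 / 2 * η + 1 / (2 * η) * (R X
            + 2 * (2 * K ^ 2 * C X)
            + 4 * gavg P0 S e L X (fun x => (ndot n x X - gQ P0 S e L X) ^ 2))) := by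
          refine Finset.sum_le_sum fun X hX => mul_le_mul_of_nonneg_left ?_ (hw X)
          refine (gfluct_le hP he hη L X).trans ?_
          have := gavg_sq_ndot_gmean_le hP he hSK L hX
          gcongr
      _ = ∑ X ∈ confs S n, weight P0 n X * e X * (7 / 2 * η + 1 / (2 * η) * (R X
            + 2 * (2 * K ^ 2 * C X) + 4 * R X)) := by
          have h := sum_gavg_sq_ndot_signal hP he L
          have h' : ∀ F : (Fin n → ℝ) → ℝ, ∑ X ∈ confs S n, weight P0 n X * e X *
              (7 / 2 * η + 1 / (2 * η) * (R X + 2 * (2 * K ^ 2 * C X) + 4 * F X))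
              = ∑ X ∈ confs S n, weight P0 n X * e X *
                  (7 / 2 * η + 1 / (2 * η) * (R X + 2 * (2 * K ^ 2 * C X)))
                + 1 / (2 * η) * 4 * ∑ X ∈ confs S n, weight P0 n X * e X * F X := by
            intro F
            rw [Finset.mul_sum, ← Finset.sum_add_distrib]
            exact Finset.sum_congr rfl fun X _ => by ring
          rw [h', h' R, h]
      _ ≤ _ := by
          refine Finset.sum_le_sum fun X hX => mul_le_mul_of_nonneg_left ?_ (hw X)
          have := gavg_gavg_sq_ndot_le hP he hSK L hX
          have : 0 ≤ 1 / (2 * η) := by positivity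
          gcongr
          linarith
  refine hsum.trans ?_
  have hfin : ∀ X, 7 / 2 * η + 1 / (2 * η) * (7 * (2 * K ^ 2 * C X))
      ≤ 7 / 2 * (η + K ^ 2 / η * (ζ + 1 / ζ * C2 X)) := by
    intro X
    have h1 : 1 / (2 * η) * (7 * (2 * K ^ 2 * C X)) = 7 * (K ^ 2 / η) * C X := by
      field_simp
    have h2 : 7 * (K ^ 2 / η) * C X ≤ 7 * (K ^ 2 / η) * (1 / 2 * ζ + 1 / (2 * ζ) * C2 X) :=
      mul_le_mul_of_nonneg_left (hCC X) (by positivity)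
    have h3 : 1 / (2 * ζ) = 1 / 2 * (1 / ζ) := by
      field_simp
    rw [h3] at h2
    rw [h1]
    linarith
  refine (Finset.sum_le_sum fun X _ => mul_le_mul_of_nonneg_left (hfin X) (hw X)).trans_eq ?_
  have hC2' : ∑ X ∈ confs S n, weight P0 n X * e X * C2 X
      = (1 / n : ℝ) ^ 2 * ∑ i, ∑ j, ∑ X ∈ confs S n,
                weight P0 n X * e X * gcov P0 S e L X i j ^ 2 := by
    simp only [hC2, Finset.mul_sum]
    rw [Finset.sum_comm]
    refine Finset.sum_congr rfl fun i _ => ?_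
    rw [Finset.sum_comm]
    exact Finset.sum_congr rfl fun j _ => Finset.sum_congr rfl fun X _ => by ring
  rw [mul_assoc (1 / ζ), ← hC2']
  simp only [Finset.mul_sum, ← Finset.sum_add_distrib]
  exact Finset.sum_congr rfl fun X _ => by ring

end Concentration

instance : IsProbabilityMeasure stdGauss := by
  unfold stdGauss
  infer_instance

/-- The standard Gaussian measure on `ι → ℝ`. -/
abbrev gaussPi (ι : Type*) [Fintype ι] : Measure (ι → ℝ) := Measure.pi fun _ : ι => stdGauss

section GaussPi

variable {ι : Type*} [Fintype ι]

lemma integrable_exp_stdGauss (t : ℝ) : Integrable (fun x => Real.exp (t * x)) stdGauss :=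
  integrable_exp_mul_gaussianReal t

lemma integral_exp_stdGauss (t : ℝ) : ∫ x, Real.exp (t * x) ∂stdGauss = Real.exp (t ^ 2 / 2) := by
  have := congrFun (mgf_id_gaussianReal (μ := 0) (v := 1)) t
  simpa [mgf, stdGauss] using this

lemma exp_add_sum_mul (a : ℝ) (v z : ι → ℝ) :
    Real.exp (a + ∑ i, v i * z i) = Real.exp a * ∏ i, Real.exp (v i * z i) := by
  rw [Real.exp_add, Real.exp_sum]

lemma integrable_exp_gaussPi (a : ℝ) (v : ι → ℝ) :
    Integrable (fun z : ι → ℝ => Real.exp (a + ∑ i, v i * z i)) (gaussPi ι) := by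
  simp only [exp_add_sum_mul]
  exact (Integrable.fintype_prod fun i => integrable_exp_stdGauss (v i)).const_mul _

lemma integral_exp_gaussPi (a : ℝ) (v : ι → ℝ) :
    ∫ z : ι → ℝ, Real.exp (a + ∑ i, v i * z i) ∂gaussPi ι
      = Real.exp (a + (∑ i, v i ^ 2) / 2) := by
  simp only [exp_add_sum_mul]
  rw [integral_const_mul, integral_fintype_prod_eq_prod (fun i x => Real.exp (v i * x)),
    Real.exp_add, Finset.sum_div, Real.exp_sum]
  simp only [integral_exp_stdGauss]

lemma integrable_eval_gaussPi (i : ι) : Integrable (fun z : ι → ℝ => z i) (gaussPi ι) := by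
  have h : Integrable (fun x : ℝ => x) stdGauss := by
    have := (memLp_id_gaussianReal (μ := 0) (v := 1) 1).integrable le_rfl
    exact this
  exact integrable_comp_eval (μ := fun _ : ι => stdGauss) (f := fun x : ℝ => x) h

lemma integral_eval_gaussPi (i : ι) : ∫ z : ι → ℝ, z i ∂gaussPi ι = 0 := by
  have h := integral_comp_eval (μ := fun _ : ι => stdGauss) (i := i) (f := fun x : ℝ => x)
    (by fun_prop)
  exact h.trans integral_id_gaussianReal

lemma integrable_sum_mul_gaussPi (v : ι → ℝ) :
    Integrable (fun z : ι → ℝ => ∑ i, v i * z i) (gaussPi ι) :=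
  integrable_finsetSum _ fun i _ => (integrable_eval_gaussPi i).const_mul _

lemma integral_sum_mul_gaussPi (v : ι → ℝ) : ∫ z : ι → ℝ, ∑ i, v i * z i ∂gaussPi ι = 0 := by
  rw [integral_finsetSum _ fun i _ => (integrable_eval_gaussPi i).const_mul _]
  simp only [integral_const_mul, integral_eval_gaussPi, mul_zero, Finset.sum_const_zero]

lemma charFun_map_mul_stdGauss (c t : ℝ) :
    charFun (stdGauss.map fun x => c * x) t = Complex.exp (-((c ^ 2 : ℝ) * t ^ 2 / 2)) := by
  rw [stdGauss, gaussianReal_map_const_mul, charFun_gaussianReal]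
  congr 1
  push_cast
  simp

/-- A linear form in independent standard Gaussians is Gaussian. -/
lemma map_sum_mul_gaussPi (v : ι → ℝ) (c : ℝ) (hc : c ^ 2 = ∑ i, v i ^ 2) :
    (gaussPi ι).map (fun z => ∑ i, v i * z i) = stdGauss.map fun x => c * x := by
  have h1 : (gaussPi ι).map (fun z => ∑ i, v i * z i)
      = (Measure.pi fun i => stdGauss.map fun x => v i * x).map (fun z => ∑ i, z i) := by
    have hp : ∀ i, IsProbabilityMeasure (stdGauss.map fun x => v i * x) := fun i =>
      Measure.isProbabilityMeasure_map (by fun_prop)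
    rw [← Measure.pi_map_pi (fun i => by fun_prop), Measure.map_map (by fun_prop) (by fun_prop)]
    rfl
  have hp : ∀ i, IsProbabilityMeasure (stdGauss.map fun x => v i * x) := fun i =>
    Measure.isProbabilityMeasure_map (by fun_prop)
  have hp' : IsProbabilityMeasure (stdGauss.map fun x => c * x) :=
    Measure.isProbabilityMeasure_map (by fun_prop)
  rw [h1]
  have hp'' : IsProbabilityMeasure
      ((Measure.pi fun i => stdGauss.map fun x => v i * x).map (fun z => ∑ i, z i)) :=
    Measure.isProbabilityMeasure_map (by fun_prop)
  refine Measure.ext_of_charFun ?_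
  rw [charFun_map_sum_pi_eq_prod]
  funext t
  rw [Finset.prod_apply]
  simp only [charFun_map_mul_stdGauss]
  rw [← Complex.exp_sum, hc]
  congr 1
  push_cast
  rw [Finset.sum_neg_distrib, Finset.sum_mul, Finset.sum_div]

lemma integral_comp_sum_mul_gaussPi (v : ι → ℝ) (c : ℝ) (hc : c ^ 2 = ∑ i, v i ^ 2) {f : ℝ → ℝ}
    (hf : Measurable f) :
    ∫ z : ι → ℝ, f (∑ i, v i * z i) ∂gaussPi ι = ∫ x, f (c * x) ∂stdGauss := by
  have h1 := integral_map (μ := gaussPi ι) (φ := fun z => ∑ i, v i * z i)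
    (Measurable.aemeasurable (by fun_prop)) (hf.aestronglyMeasurable)
  have h2 := integral_map (μ := stdGauss) (φ := fun z => c * z) (by fun_prop)
    (hf.aestronglyMeasurable)
  rw [← h1, ← h2, map_sum_mul_gaussPi v c hc]

lemma stdGauss_map_add (m : ℝ) : stdGauss.map (fun x => x + m)
    = stdGauss.withDensity fun x => ENNReal.ofReal (Real.exp (m * x - m ^ 2 / 2)) := by
  rw [stdGauss, gaussianReal_map_add_const, gaussianReal_of_var_ne_zero _ one_ne_zero,
    gaussianReal_of_var_ne_zero _ one_ne_zero, ← withDensity_mul _ (by fun_prop) (by fun_prop)]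
  congr 1
  funext x
  simp only [gaussianPDF, Pi.mul_apply, gaussianPDFReal]
  rw [← ENNReal.ofReal_mul (by positivity), mul_assoc _ (Real.exp _), ← Real.exp_add]
  congr 3
  simp
  ring

/-- Cameron--Martin formula for the product Gaussian measure. -/
lemma gaussPi_map_add (m : ι → ℝ) : (gaussPi ι).map (fun z => z + m)
    = (gaussPi ι).withDensity fun y =>
        ENNReal.ofReal (Real.exp (-((∑ i, m i ^ 2) / 2) + ∑ i, m i * y i)) := by
  have hp : ∀ i, IsProbabilityMeasure (stdGauss.map fun x => x + m i) := fun i =>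
    Measure.isProbabilityMeasure_map (by fun_prop)
  have h1 : (gaussPi ι).map (fun z => z + m) = Measure.pi fun i => stdGauss.map fun x => x + m i :=
    Measure.pi_map_pi (μ := fun _ : ι => stdGauss) (f := fun i x => x + m i)
      (fun i => by fun_prop)
  rw [h1]
  refine Measure.pi_eq fun s hs => ?_
  have hint : ∀ i, Integrable (fun x => Real.exp (m i * x - m i ^ 2 / 2))
      (stdGauss.restrict (s i)) := by
    intro i
    simp only [sub_eq_add_neg, Real.exp_add]
    exact ((integrable_exp_stdGauss (m i)).mul_const _).restrict
  rw [withDensity_apply _ (MeasurableSet.univ_pi hs), Measure.restrict_pi_pi]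
  have h2 : ∀ y : ι → ℝ, Real.exp (-((∑ i, m i ^ 2) / 2) + ∑ i, m i * y i)
      = ∏ i, Real.exp (m i * y i - m i ^ 2 / 2) := by
    intro y
    rw [← Real.exp_sum, Finset.sum_sub_distrib, Finset.sum_div]
    congr 1
    ring
  simp only [h2]
  rw [← ofReal_integral_eq_lintegral_ofReal (Integrable.fintype_prod hint)
    (Eventually.of_forall fun y => Finset.prod_nonneg fun i _ => (Real.exp_pos _).le),
    integral_fintype_prod_eq_prod (fun i x => Real.exp (m i * x - m i ^ 2 / 2)),
    ENNReal.ofReal_prod_of_nonneg fun i _ => integral_nonneg fun x => (Real.exp_pos _).le]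
  refine Finset.prod_congr rfl fun i _ => ?_
  rw [ofReal_integral_eq_lintegral_ofReal (hint i)
    (Eventually.of_forall fun y => (Real.exp_pos _).le), stdGauss_map_add,
    withDensity_apply _ (hs i)]

lemma integral_gaussPi_add (m : ι → ℝ) (f : (ι → ℝ) → ℝ) :
    ∫ z, f (z + m) ∂gaussPi ι
      = ∫ y, Real.exp (-((∑ i, m i ^ 2) / 2) + ∑ i, m i * y i) * f y ∂gaussPi ι := by
  have h := integral_map_equiv (μ := gaussPi ι) (MeasurableEquiv.addRight m) f
  simp only [MeasurableEquiv.coe_addRight] at h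
  rw [← h, gaussPi_map_add, integral_withDensity_eq_integral_toReal_smul (by fun_prop)
    (Eventually.of_forall fun _ => ENNReal.ofReal_lt_top)]
  refine integral_congr_ae (Eventually.of_forall fun y => ?_)
  simp only [smul_eq_mul]
  rw [ENNReal.toReal_ofReal (Real.exp_pos _).le]

end GaussPi

section LogSumExp

variable {ι κ : Type*} [Fintype ι]

/-- A mixture of exponentials of affine forms. -/
def mixExp (T : Finset κ) (p : κ → ℝ) (α : κ → ℝ) (v : κ → ι → ℝ) (z : ι → ℝ) : ℝ :=
  ∑ k ∈ T, p k * Real.exp (α k + ∑ i, v k i * z i)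

/-- The exponent in the Gaussian expectation of the product of two exponentials of affine forms. -/
def pairExp (α : κ → ℝ) (v : κ → ι → ℝ) (β : κ → ℝ) (w : κ → ι → ℝ) (k l : κ) : ℝ :=
  α k + β l + (∑ i, (v k i + w l i) ^ 2) / 2

variable {T : Finset κ} {p : κ → ℝ} {α β : κ → ℝ} {v w : κ → ι → ℝ}

lemma measurable_mixExp : Measurable (mixExp T p α v) := by
  unfold mixExp
  fun_prop

lemma exp_sum_le_mixExp (hp : ∀ k ∈ T, 0 ≤ p k) (hp1 : ∑ k ∈ T, p k = 1) (z : ι → ℝ) :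
    Real.exp (∑ k ∈ T, p k * (α k + ∑ i, v k i * z i)) ≤ mixExp T p α v z := by
  have := convexOn_exp.map_sum_le (p := fun k => α k + ∑ i, v k i * z i) hp hp1
    (fun _ _ => Set.mem_univ _)
  simp only [smul_eq_mul] at this
  exact this

lemma mixExp_pos (hp : ∀ k ∈ T, 0 ≤ p k) (hp1 : ∑ k ∈ T, p k = 1) (z : ι → ℝ) :
    0 < mixExp T p α v z :=
  (Real.exp_pos _).trans_le (exp_sum_le_mixExp hp hp1 z)

lemma inv_mixExp_sq_le (hp : ∀ k ∈ T, 0 ≤ p k) (hp1 : ∑ k ∈ T, p k = 1) (z : ι → ℝ) :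
    (mixExp T p α v z)⁻¹ ^ 2
      ≤ mixExp T p (fun k => -2 * α k) (fun k i => -2 * v k i) z := by
  refine le_trans ?_ (exp_sum_le_mixExp hp hp1 z)
  have h := exp_sum_le_mixExp (α := α) (v := v) hp hp1 z
  have h1 : (mixExp T p α v z)⁻¹ ≤ Real.exp (-∑ k ∈ T, p k * (α k + ∑ i, v k i * z i)) := by
    rw [Real.exp_neg]
    exact inv_anti₀ (Real.exp_pos _) h
  have h2 : ∑ k ∈ T, p k * (-2 * α k + ∑ i, -2 * v k i * z i)
      = 2 * -∑ k ∈ T, p k * (α k + ∑ i, v k i * z i) := by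
    rw [← Finset.sum_neg_distrib, Finset.mul_sum]
    refine Finset.sum_congr rfl fun k _ => ?_
    simp only [mul_assoc, ← Finset.mul_sum]
    ring
  rw [h2, two_mul, Real.exp_add, ← sq]
  exact pow_le_pow_left₀ (inv_nonneg.2 (mixExp_pos hp hp1 z).le) h1 2

lemma abs_log_mixExp_le (hp : ∀ k ∈ T, 0 ≤ p k) (hp1 : ∑ k ∈ T, p k = 1) {a B : ℝ}
    (hα : ∀ k ∈ T, |α k| ≤ a) (hv : ∀ k ∈ T, ∀ i, |v k i| ≤ B) (z : ι → ℝ) :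
    |Real.log (mixExp T p α v z)| ≤ a + B * ∑ i, |z i| := by
  have h : ∀ k ∈ T, |α k + ∑ i, v k i * z i| ≤ a + B * ∑ i, |z i| := by
    intro k hk
    refine (abs_add_le _ _).trans (add_le_add (hα k hk) ?_)
    rw [Finset.mul_sum]
    refine (Finset.abs_sum_le_sum_abs _ _).trans (Finset.sum_le_sum fun i _ => ?_)
    rw [abs_mul]
    exact mul_le_mul_of_nonneg_right (hv k hk i) (abs_nonneg _)
  have hpos := mixExp_pos (α := α) (v := v) hp hp1 z
  set c := a + B * ∑ i, |z i|
  rw [abs_le]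
  constructor
  · rw [Real.le_log_iff_exp_le hpos]
    calc Real.exp (-c) = ∑ k ∈ T, p k * Real.exp (-c) := by rw [← Finset.sum_mul, hp1, one_mul]
      _ ≤ _ := Finset.sum_le_sum fun k hk => mul_le_mul_of_nonneg_left
          (Real.exp_le_exp.2 (abs_le.1 (h k hk)).1) (hp k hk)
  · rw [Real.log_le_iff_le_exp hpos]
    calc mixExp T p α v z ≤ ∑ k ∈ T, p k * Real.exp c :=
          Finset.sum_le_sum fun k hk => mul_le_mul_of_nonneg_left
            (Real.exp_le_exp.2 (abs_le.1 (h k hk)).2) (hp k hk)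
      _ = Real.exp c := by rw [← Finset.sum_mul, hp1, one_mul]

lemma integrable_sum_abs_gaussPi (a B : ℝ) :
    Integrable (fun z : ι → ℝ => a + B * ∑ i, |z i|) (gaussPi ι) :=
  (integrable_const a).add
    ((integrable_finsetSum _ fun i _ => (integrable_eval_gaussPi i).abs).const_mul B)

lemma integrable_log_mixExp (hp : ∀ k ∈ T, 0 ≤ p k) (hp1 : ∑ k ∈ T, p k = 1) :
    Integrable (fun z => Real.log (mixExp T p α v z)) (gaussPi ι) := by
  refine (integrable_sum_abs_gaussPi (∑ k ∈ T, |α k|) (∑ k ∈ T, ∑ i, |v k i|)).mono'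
    (Real.measurable_log.comp measurable_mixExp).aestronglyMeasurable
    (Eventually.of_forall fun z => ?_)
  refine abs_log_mixExp_le hp hp1 (fun k hk => ?_) (fun k hk i => ?_) z
  · exact Finset.single_le_sum (f := fun k => |α k|) (fun _ _ => abs_nonneg _) hk
  · refine le_trans (Finset.single_le_sum (f := fun i => |v k i|) (fun _ _ => abs_nonneg _)
      (Finset.mem_univ i)) ?_
    exact Finset.single_le_sum (f := fun k => ∑ i, |v k i|)
      (fun _ _ => Finset.sum_nonneg fun _ _ => abs_nonneg _) hk

lemma integrable_mixExp : Integrable (mixExp T p α v) (gaussPi ι) :=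
  integrable_finsetSum _ fun k _ => (integrable_exp_gaussPi (α k) (v k)).const_mul _

lemma integral_mixExp : ∫ z, mixExp T p α v z ∂gaussPi ι
    = ∑ k ∈ T, p k * Real.exp (α k + (∑ i, v k i ^ 2) / 2) := by
  unfold mixExp
  rw [integral_finsetSum _ fun k _ => (integrable_exp_gaussPi (α k) (v k)).const_mul _]
  simp only [integral_const_mul, integral_exp_gaussPi]

lemma mixExp_mul (z : ι → ℝ) : mixExp T p α v z * mixExp T p β w z
    = mixExp (T ×ˢ T) (fun q => p q.1 * p q.2) (fun q => α q.1 + β q.2)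
        (fun q i => v q.1 i + w q.2 i) z := by
  simp only [mixExp]
  rw [Finset.sum_mul_sum, ← Finset.sum_product']
  refine Finset.sum_congr rfl fun q _ => ?_
  rw [mul_mul_mul_comm, ← Real.exp_add]
  congr 2
  simp only [add_mul, Finset.sum_add_distrib]
  ring

lemma integrable_mixExp_mul :
    Integrable (fun z => mixExp T p α v z * mixExp T p β w z) (gaussPi ι) := by
  simp only [mixExp_mul]
  exact integrable_mixExp

lemma integral_mixExp_mul : ∫ z, mixExp T p α v z * mixExp T p β w z ∂gaussPi ι
    = ∑ q ∈ T ×ˢ T, p q.1 * p q.2 * Real.exp (pairExp α v β w q.1 q.2) := by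
  simp only [mixExp_mul]
  exact integral_mixExp

lemma abs_exp_sub_exp_le {a b M : ℝ} (ha : a ≤ M) (hb : b ≤ M) :
    |Real.exp a - Real.exp b| ≤ Real.exp M * |a - b| := by
  have key : ∀ a b : ℝ, a ≤ M → b ≤ a → Real.exp a - Real.exp b ≤ Real.exp M * (a - b) := by
    intro a b ha hab
    have h1 : Real.exp b = Real.exp a * Real.exp (b - a) := by rw [← Real.exp_add]; ring_nf
    have h2 := Real.add_one_le_exp (b - a)
    have h3 : Real.exp a * (a - b) ≤ Real.exp M * (a - b) :=
      mul_le_mul_of_nonneg_right (Real.exp_le_exp.2 ha) (sub_nonneg.2 hab)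
    nlinarith [Real.exp_pos a]
  rcases le_total b a with h | h
  · rw [abs_of_nonneg (sub_nonneg.2 (Real.exp_le_exp.2 h)), abs_of_nonneg (sub_nonneg.2 h)]
    exact key a b ha h
  · rw [abs_sub_comm, abs_sub_comm a, abs_of_nonneg (sub_nonneg.2 (Real.exp_le_exp.2 h)),
      abs_of_nonneg (sub_nonneg.2 h)]
    exact key b a hb h

lemma abs_log_sub_log_le {U V δ : ℝ} (hU : 0 < U) (hV : 0 < V) (hδ : 0 < δ) :
    |Real.log U - Real.log V| ≤ 1 / (2 * δ) * (U - V) ^ 2 + δ * (U⁻¹ ^ 2 + V⁻¹ ^ 2) := by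
  have key : ∀ U V : ℝ, 0 < U → 0 < V → Real.log U - Real.log V ≤ |U - V| * V⁻¹ := by
    intro U V hU hV
    rw [← Real.log_div hU.ne' hV.ne']
    have h1 := Real.log_le_sub_one_of_pos (div_pos hU hV)
    have h2 : U / V - 1 = (U - V) * V⁻¹ := by field_simp
    rw [h2] at h1
    exact h1.trans (mul_le_mul_of_nonneg_right (le_abs_self _) (inv_pos.2 hV).le)
  have hu := inv_pos.2 hU
  have hv := inv_pos.2 hV
  have h1 : |Real.log U - Real.log V| ≤ |U - V| * (U⁻¹ + V⁻¹) := by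
    rw [abs_le]
    have h2 := key U V hU hV
    have h3 := key V U hV hU
    rw [abs_sub_comm] at h3
    have h4 := mul_nonneg (abs_nonneg (U - V)) hu.le
    have h5 := mul_nonneg (abs_nonneg (U - V)) hv.le
    constructor <;> linarith
  refine h1.trans ?_
  have h6 : 1 / (2 * δ) * (U - V) ^ 2 + δ * (U⁻¹ ^ 2 + V⁻¹ ^ 2) - |U - V| * (U⁻¹ + V⁻¹)
      = 1 / (2 * δ) * (|U - V| - δ * (U⁻¹ + V⁻¹)) ^ 2 + δ / 2 * (U⁻¹ - V⁻¹) ^ 2 := by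
    rw [← sq_abs (U - V)]
    field_simp
    ring
  have h7 : 0 ≤ 1 / (2 * δ) * (|U - V| - δ * (U⁻¹ + V⁻¹)) ^ 2 + δ / 2 * (U⁻¹ - V⁻¹) ^ 2 := by
    positivity
  linarith

lemma integrable_inv_mixExp_sq (hp : ∀ k ∈ T, 0 ≤ p k) (hp1 : ∑ k ∈ T, p k = 1) :
    Integrable (fun z => (mixExp T p α v z)⁻¹ ^ 2) (gaussPi ι) := by
  refine (integrable_mixExp (T := T) (p := p) (α := fun k => -2 * α k)
    (v := fun k i => -2 * v k i)).mono' (measurable_mixExp.inv.pow_const 2).aestronglyMeasurable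
    (Eventually.of_forall fun z => ?_)
  rw [Real.norm_of_nonneg (sq_nonneg _)]
  exact inv_mixExp_sq_le hp hp1 z

lemma integral_inv_mixExp_sq_le (hp : ∀ k ∈ T, 0 ≤ p k) (hp1 : ∑ k ∈ T, p k = 1) {a M : ℝ}
    (hα : ∀ k ∈ T, |α k| ≤ a) (hv : ∀ k ∈ T, ∑ i, v k i ^ 2 ≤ M) :
    ∫ z, (mixExp T p α v z)⁻¹ ^ 2 ∂gaussPi ι ≤ Real.exp (2 * a + 2 * M) := by
  refine (integral_mono (integrable_inv_mixExp_sq hp hp1) integrable_mixExp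
    (inv_mixExp_sq_le hp hp1)).trans ?_
  rw [integral_mixExp]
  calc _ ≤ ∑ k ∈ T, p k * Real.exp (2 * a + 2 * M) := by
        refine Finset.sum_le_sum fun k hk => mul_le_mul_of_nonneg_left
          (Real.exp_le_exp.2 ?_) (hp k hk)
        have h1 := (abs_le.1 (hα k hk)).1
        have h2 := hv k hk
        simp only [mul_pow, ← Finset.mul_sum]
        linarith
    _ = _ := by rw [← Finset.sum_mul, hp1, one_mul]

/-- Second-moment comparison of the expected logarithms of two mixtures of exponentials. -/
lemma abs_integral_log_mixExp_sub_le (hp : ∀ k ∈ T, 0 ≤ p k) (hp1 : ∑ k ∈ T, p k = 1)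
    {a M M' δ : ℝ} (hδ : 0 < δ)
    (hα : ∀ k ∈ T, |α k| ≤ a) (hv : ∀ k ∈ T, ∑ i, v k i ^ 2 ≤ M)
    (hβ : ∀ k ∈ T, |β k| ≤ a) (hw : ∀ k ∈ T, ∑ i, w k i ^ 2 ≤ M)
    (h11 : ∀ k ∈ T, ∀ l ∈ T, pairExp α v α v k l ≤ M')
    (h12 : ∀ k ∈ T, ∀ l ∈ T, pairExp α v β w k l ≤ M')
    (h22 : ∀ k ∈ T, ∀ l ∈ T, pairExp β w β w k l ≤ M') :
    |∫ z, Real.log (mixExp T p α v z) ∂gaussPi ι - ∫ z, Real.log (mixExp T p β w z) ∂gaussPi ι|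
      ≤ 1 / (2 * δ) * (Real.exp M' * ∑ q ∈ T ×ˢ T, p q.1 * p q.2 *
          (|pairExp α v α v q.1 q.2 - pairExp β w β w q.1 q.2|
            + 2 * |pairExp α v β w q.1 q.2 - pairExp β w β w q.1 q.2|))
        + 2 * δ * Real.exp (2 * a + 2 * M) := by
  set U := mixExp T p α v
  set V := mixExp T p β w
  have i1 : Integrable (fun z => U z * U z) (gaussPi ι) := integrable_mixExp_mul
  have i2 : Integrable (fun z => 2 * (U z * V z)) (gaussPi ι) := integrable_mixExp_mul.const_mul 2
  have i3 : Integrable (fun z => V z * V z) (gaussPi ι) := integrable_mixExp_mul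
  have hexp : (fun z => (U z - V z) ^ 2)
      = fun z => U z * U z - 2 * (U z * V z) + V z * V z := by
    funext z
    ring
  have hsqi : Integrable (fun z => (U z - V z) ^ 2) (gaussPi ι) := by
    rw [hexp]
    exact (i1.sub i2).add i3
  have hsq : ∫ z, (U z - V z) ^ 2 ∂gaussPi ι ≤ Real.exp M' * ∑ q ∈ T ×ˢ T, p q.1 * p q.2 *
          (|pairExp α v α v q.1 q.2 - pairExp β w β w q.1 q.2|
            + 2 * |pairExp α v β w q.1 q.2 - pairExp β w β w q.1 q.2|) := by
    have hI : ∫ z, (U z - V z) ^ 2 ∂gaussPi ι = ∫ z, U z * U z ∂gaussPi ι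
        - 2 * ∫ z, U z * V z ∂gaussPi ι + ∫ z, V z * V z ∂gaussPi ι := by
      have e1 := integral_add (i1.sub i2) i3
      have e2 := integral_sub i1 i2
      simp only [Pi.sub_apply, integral_const_mul] at e1 e2
      rw [hexp, e1, e2]
    rw [hI, integral_mixExp_mul,
      integral_mixExp_mul, integral_mixExp_mul, Finset.mul_sum, Finset.mul_sum,
      ← Finset.sum_sub_distrib, ← Finset.sum_add_distrib]
    refine Finset.sum_le_sum fun q hq => ?_
    rw [Finset.mem_product] at hq
    have e1 := abs_exp_sub_exp_le (h11 _ hq.1 _ hq.2) (h22 _ hq.1 _ hq.2)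
    have e2 := abs_exp_sub_exp_le (h12 _ hq.1 _ hq.2) (h22 _ hq.1 _ hq.2)
    have e3 := mul_nonneg (hp _ hq.1) (hp _ hq.2)
    have e4 := (abs_le.1 e1).2
    have e5 := (abs_le.1 e2).1
    calc _ = p q.1 * p q.2 * (Real.exp (pairExp α v α v q.1 q.2)
          - 2 * Real.exp (pairExp α v β w q.1 q.2) + Real.exp (pairExp β w β w q.1 q.2)) := by ring
      _ ≤ p q.1 * p q.2 * (Real.exp M' *
          (|pairExp α v α v q.1 q.2 - pairExp β w β w q.1 q.2|
            + 2 * |pairExp α v β w q.1 q.2 - pairExp β w β w q.1 q.2|)) :=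
          mul_le_mul_of_nonneg_left (by linarith) e3
      _ = _ := by ring
  have hIU := integrable_log_mixExp (α := α) (v := v) hp hp1
  have hIV := integrable_log_mixExp (α := β) (v := w) hp hp1
  have hiU := integrable_inv_mixExp_sq (α := α) (v := v) hp hp1
  have hiV := integrable_inv_mixExp_sq (α := β) (v := w) hp hp1
  rw [← integral_sub hIU hIV]
  refine (abs_integral_le_integral_abs).trans ?_
  refine (integral_mono (hIU.sub hIV).abs
    ((hsqi.const_mul (1 / (2 * δ))).add ((hiU.add hiV).const_mul δ)) fun z =>
      abs_log_sub_log_le (mixExp_pos hp hp1 z) (mixExp_pos hp hp1 z) hδ).trans ?_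
  have hsum := integral_add (hsqi.const_mul (1 / (2 * δ))) ((hiU.add hiV).const_mul δ)
  have hsum2 := integral_add hiU hiV
  simp only [integral_const_mul, Pi.add_apply] at hsum hsum2 ⊢
  rw [hsum, hsum2]
  have f1 := integral_inv_mixExp_sq_le hp hp1 hα hv
  have f2 := integral_inv_mixExp_sq_le hp hp1 hβ hw
  have f3 : 0 ≤ 1 / (2 * δ) := by positivity
  have f4 := mul_le_mul_of_nonneg_left hsq f3
  have f5 := mul_le_mul_of_nonneg_left (add_le_add f1 f2) hδ.le
  linarith

end LogSumExp

section Cavity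

variable {n : ℕ}

lemma abs_ndot_le (hn : 0 < n) {K : ℝ} {u w : Fin n → ℝ} (hu : ∀ i, |u i| ≤ K)
    (hw : ∀ i, |w i| ≤ K) : |ndot n u w| ≤ K ^ 2 := by
  have hn' : (0 : ℝ) < n := by exact_mod_cast hn
  have h : |∑ i, u i * w i| ≤ n * K ^ 2 := by
    calc |∑ i, u i * w i| ≤ ∑ _i : Fin n, K ^ 2 := by
          refine (Finset.abs_sum_le_sum_abs _ _).trans (Finset.sum_le_sum fun i _ => ?_)
          rw [abs_mul, sq]
          exact mul_le_mul (hu i) (hw i) (abs_nonneg _) ((abs_nonneg _).trans (hu i))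
      _ = n * K ^ 2 := by simp
  rw [ndot, abs_mul, abs_of_nonneg (by positivity)]
  calc (1 / n : ℝ) * |∑ i, u i * w i| ≤ 1 / n * (n * K ^ 2) :=
        mul_le_mul_of_nonneg_left h (by positivity)
    _ = K ^ 2 := by field_simp

/-- Deterministic part of the cavity exponent with spin `σ`, signal `s`, configuration `u` and
signal overlap `r`. -/
def cavShift (n : ℕ) (lam s σ r : ℝ) (u : Fin n → ℝ) : ℝ :=
  lam * σ * s * r - lam / 2 * σ ^ 2 * ndot n u u

/-- Coefficients of the Gaussian part of the cavity exponent. -/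
def cavCoef (n : ℕ) (lam σ : ℝ) (u : Fin n → ℝ) : Fin n → ℝ :=
  fun i => σ * Real.sqrt (lam / n) * u i

lemma sum_cavCoef_mul (hn : 0 < n) {lam : ℝ} (hlam : 0 ≤ lam) (σ σ' : ℝ) (u u' : Fin n → ℝ) :
    ∑ i, cavCoef n lam σ u i * cavCoef n lam σ' u' i = lam * σ * σ' * ndot n u u' := by
  have hn' : (0 : ℝ) < n := by exact_mod_cast hn
  have hs : Real.sqrt (lam / n) * Real.sqrt (lam / n) = lam / n := Real.mul_self_sqrt (by positivity)
  calc ∑ i, cavCoef n lam σ u i * cavCoef n lam σ' u' i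
      = ∑ i, σ * σ' * (Real.sqrt (lam / n) * Real.sqrt (lam / n)) * (u i * u' i) :=
        Finset.sum_congr rfl fun i _ => by simp only [cavCoef]; ring
    _ = _ := by
      rw [← Finset.mul_sum, hs, ndot]
      field_simp

lemma sum_cavCoef_sq (hn : 0 < n) {lam : ℝ} (hlam : 0 ≤ lam) (σ : ℝ) (u : Fin n → ℝ) :
    ∑ i, cavCoef n lam σ u i ^ 2 = lam * σ ^ 2 * ndot n u u := by
  simp only [sq, sum_cavCoef_mul hn hlam]
  ring

lemma cav_pair (hn : 0 < n) {lam : ℝ} (hlam : 0 ≤ lam) (s σ σ' r r' : ℝ) (u u' : Fin n → ℝ) :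
    cavShift n lam s σ r u + cavShift n lam s σ' r' u'
        + (∑ i, (cavCoef n lam σ u i + cavCoef n lam σ' u' i) ^ 2) / 2
      = lam * s * (σ * r + σ' * r') + lam * σ * σ' * ndot n u u' := by
  have h : ∑ i, (cavCoef n lam σ u i + cavCoef n lam σ' u' i) ^ 2
      = ∑ i, cavCoef n lam σ u i ^ 2 + 2 * ∑ i, cavCoef n lam σ u i * cavCoef n lam σ' u' i
        + ∑ i, cavCoef n lam σ' u' i ^ 2 := by
    rw [Finset.mul_sum, ← Finset.sum_add_distrib, ← Finset.sum_add_distrib]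
    exact Finset.sum_congr rfl fun i _ => by ring
  rw [h, sum_cavCoef_sq hn hlam, sum_cavCoef_sq hn hlam, sum_cavCoef_mul hn hlam]
  simp only [cavShift]
  ring

lemma abs_cavShift_le (hn : 0 < n) {lam s σ r K : ℝ} (hlam : 0 ≤ lam) {u : Fin n → ℝ}
    (hs : |s| ≤ K) (hσ : |σ| ≤ K) (hr : |r| ≤ K ^ 2) (hu : ∀ i, |u i| ≤ K) :
    |cavShift n lam s σ r u| ≤ 2 * lam * K ^ 4 := by
  have hK : 0 ≤ K := (abs_nonneg _).trans hs
  have h1 : |lam * σ * s * r| ≤ lam * K * K * K ^ 2 := by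
    rw [abs_mul, abs_mul, abs_mul, abs_of_nonneg hlam]
    gcongr
  have h2 : |lam / 2 * σ ^ 2 * ndot n u u| ≤ lam / 2 * K ^ 2 * K ^ 2 := by
    rw [abs_mul, abs_mul, abs_of_nonneg (by positivity : 0 ≤ lam / 2), abs_pow]
    have := abs_ndot_le hn hu hu
    gcongr
  have h3 := abs_sub (lam * σ * s * r) (lam / 2 * σ ^ 2 * ndot n u u)
  have h4 : 0 ≤ lam * K ^ 4 := by positivity
  unfold cavShift
  nlinarith

lemma sum_cavCoef_sq_le (hn : 0 < n) {lam σ K : ℝ} (hlam : 0 ≤ lam) {u : Fin n → ℝ}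
    (hσ : |σ| ≤ K) (hu : ∀ i, |u i| ≤ K) : ∑ i, cavCoef n lam σ u i ^ 2 ≤ lam * K ^ 4 := by
  rw [sum_cavCoef_sq hn hlam]
  have h1 := (le_abs_self _).trans (abs_ndot_le hn hu hu)
  have h2 : σ ^ 2 ≤ K ^ 2 := sq_le_sq' (by linarith [(abs_le.1 hσ).1]) (abs_le.1 hσ).2
  calc lam * σ ^ 2 * ndot n u u ≤ lam * σ ^ 2 * K ^ 2 :=
        mul_le_mul_of_nonneg_left h1 (by positivity)
    _ ≤ lam * K ^ 2 * K ^ 2 := by gcongr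
    _ = _ := by ring

lemma cav_pair_le (hn : 0 < n) {lam s σ σ' r r' K : ℝ} (hlam : 0 ≤ lam) {u u' : Fin n → ℝ}
    (hs : |s| ≤ K) (hσ : |σ| ≤ K) (hσ' : |σ'| ≤ K) (hr : |r| ≤ K ^ 2) (hr' : |r'| ≤ K ^ 2)
    (hu : ∀ i, |u i| ≤ K) (hu' : ∀ i, |u' i| ≤ K) :
    cavShift n lam s σ r u + cavShift n lam s σ' r' u'
        + (∑ i, (cavCoef n lam σ u i + cavCoef n lam σ' u' i) ^ 2) / 2 ≤ 3 * lam * K ^ 4 := by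
  have hK : 0 ≤ K := (abs_nonneg _).trans hs
  rw [cav_pair hn hlam]
  have hd := abs_ndot_le hn hu hu'
  have key : ∀ a b c : ℝ, |a| ≤ K → |b| ≤ K → |c| ≤ K ^ 2 → lam * (a * b * c) ≤ lam * K ^ 4 := by
    intro a b c ha hb hc
    refine mul_le_mul_of_nonneg_left ((le_abs_self _).trans ?_) hlam
    rw [abs_mul, abs_mul]
    calc |a| * |b| * |c| ≤ K * K * K ^ 2 := by gcongr
      _ = K ^ 4 := by ring
  linarith [key s σ r hs hσ hr, key s σ' r' hs hσ' hr', key σ σ' _ hσ hσ' hd]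

variable {P0 : Measure ℝ} {S : Finset ℝ} {e : (Fin n → ℝ) → ℝ}

/-- The revealed spin when `l` holds, the sampled one otherwise. -/
def mixSpin (l : Bool) (s σ : ℝ) : ℝ := if l then s else σ

lemma sum_prod_gwt (hP : ∑ s ∈ S, (P0 {s}).toReal = 1) (L : Fin n → Bool) (X : Fin n → ℝ)
    (f : (Fin n → ℝ) → (Fin n → ℝ) → ℝ) :
    ∑ q ∈ (confs S n ×ˢ S) ×ˢ (confs S n ×ˢ S), gwt P0 S e L X q.1.1 * (P0 {q.1.2}).toReal *
        (gwt P0 S e L X q.2.1 * (P0 {q.2.2}).toReal) * f (mix L X q.1.1) (mix L X q.2.1)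
      = gavg P0 S e L X fun x => gavg P0 S e L X fun x' => f x x' := by
  have h : ∀ g : (Fin n → ℝ) → ℝ, ∑ q ∈ confs S n ×ˢ S,
      gwt P0 S e L X q.1 * (P0 {q.2}).toReal * g (mix L X q.1) = gavg P0 S e L X g := by
    intro g
    rw [gavg_eq_sum, Finset.sum_product]
    refine Finset.sum_congr rfl fun x _ => ?_
    simp only [mul_assoc, ← Finset.mul_sum]
    rw [← Finset.sum_mul, hP, one_mul]
  rw [Finset.sum_product]
  rw [← h]
  refine Finset.sum_congr rfl fun q _ => ?_
  rw [← h, Finset.mul_sum]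
  exact Finset.sum_congr rfl fun q' _ => by ring

/-- The cavity partition function with the sampled configuration. -/
def cavU (P0 : Measure ℝ) (S : Finset ℝ) (lam : ℝ) (e : (Fin n → ℝ) → ℝ) (L : Fin n → Bool)
    (X : Fin n → ℝ) (l : Bool) (s : ℝ) : (Fin n → ℝ) → ℝ :=
  mixExp (confs S n ×ˢ S) (fun k => gwt P0 S e L X k.1 * (P0 {k.2}).toReal)
    (fun k => cavShift n lam s (mixSpin l s k.2) (ndot n (mix L X k.1) X) (mix L X k.1))
    (fun k => cavCoef n lam (mixSpin l s k.2) (mix L X k.1))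

/-- The cavity partition function with the configuration replaced by its posterior mean. -/
def cavV (P0 : Measure ℝ) (S : Finset ℝ) (lam : ℝ) (e : (Fin n → ℝ) → ℝ) (L : Fin n → Bool)
    (X : Fin n → ℝ) (l : Bool) (s : ℝ) : (Fin n → ℝ) → ℝ :=
  mixExp (confs S n ×ˢ S) (fun k => gwt P0 S e L X k.1 * (P0 {k.2}).toReal)
    (fun k => cavShift n lam s (mixSpin l s k.2) (gQ P0 S e L X) (gmean P0 S e L X))
    (fun k => cavCoef n lam (mixSpin l s k.2) (gmean P0 S e L X))

lemma cav_weight_nonneg (he : ∀ x, 0 < e x) (L : Fin n → Bool) (X : Fin n → ℝ) :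
    ∀ k ∈ confs S n ×ˢ S, 0 ≤ gwt P0 S e L X k.1 * (P0 {k.2}).toReal :=
  fun k _ => mul_nonneg (gwt_nonneg he L X k.1) ENNReal.toReal_nonneg

lemma sum_cav_weight (hP : ∑ s ∈ S, (P0 {s}).toReal = 1) (he : ∀ x, 0 < e x)
    (L : Fin n → Bool) (X : Fin n → ℝ) :
    ∑ k ∈ confs S n ×ˢ S, gwt P0 S e L X k.1 * (P0 {k.2}).toReal = 1 := by
  rw [Finset.sum_product]
  simp only [← Finset.mul_sum, hP, mul_one, sum_gwt hP he]

lemma abs_gQ_le (hn : 0 < n) (hP : ∑ s ∈ S, (P0 {s}).toReal = 1) (he : ∀ x, 0 < e x) {K : ℝ}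
    (hSK : ∀ x ∈ S, |x| ≤ K) (L : Fin n → Bool) {X : Fin n → ℝ} (hX : X ∈ confs S n) :
    |gQ P0 S e L X| ≤ K ^ 2 := by
  rw [gQ_eq_ndot]
  exact abs_ndot_le hn (abs_gmean_le hP he hSK L hX) (abs_gmean_le hP he hSK L hX)

/-- Comparison of the two cavity partition functions in terms of overlap fluctuations. -/
lemma abs_integral_log_cav_sub_le (hn : 0 < n) (hP : ∑ s ∈ S, (P0 {s}).toReal = 1)
    (he : ∀ x, 0 < e x) {K lam δ : ℝ} (hlam : 0 < lam) (hδ : 0 < δ) (hSK : ∀ x ∈ S, |x| ≤ K)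
    (L : Fin n → Bool) {X : Fin n → ℝ} (hX : X ∈ confs S n) (l : Bool) {s : ℝ} (hs : s ∈ S) :
    |∫ z, Real.log (cavU P0 S lam e L X l s z) ∂gaussPi (Fin n)
        - ∫ z, Real.log (cavV P0 S lam e L X l s z) ∂gaussPi (Fin n)|
      ≤ 1 / (2 * δ) * (Real.exp (3 * lam * K ^ 4) * (lam * K ^ 2 * gfluct P0 S e L X))
        + 2 * δ * Real.exp (2 * (2 * lam * K ^ 4) + 2 * (lam * K ^ 4)) := by
  set b := gmean P0 S e L X with hb
  set Q := gQ P0 S e L X with hQ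
  have hs' := hSK s hs
  have hσ : ∀ k ∈ confs S n ×ˢ S, |mixSpin l s k.2| ≤ K := by
    intro k hk
    unfold mixSpin
    split_ifs
    · exact hs'
    · exact hSK _ (Finset.mem_product.1 hk).2
  have hconf : ∀ x ∈ confs S n, ∀ i, |x i| ≤ K := fun x hx i =>
    hSK _ (Fintype.mem_piFinset.1 hx i)
  have hx : ∀ k ∈ confs S n ×ˢ S, ∀ i, |mix L X k.1 i| ≤ K := fun k hk =>
    hconf _ (mix_mem_confs L hX (Finset.mem_product.1 hk).1)
  have hbK : ∀ i, |b i| ≤ K := abs_gmean_le hP he hSK L hX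
  have hQK : |Q| ≤ K ^ 2 := abs_gQ_le hn hP he hSK L hX
  have hr : ∀ k ∈ confs S n ×ˢ S, |ndot n (mix L X k.1) X| ≤ K ^ 2 := fun k hk =>
    abs_ndot_le hn (hx k hk) (hconf X hX)
  have hl := hlam.le
  have main := abs_integral_log_mixExp_sub_le (cav_weight_nonneg (P0 := P0) (S := S) he L X)
    (sum_cav_weight hP he L X) hδ
    (α := fun k => cavShift n lam s (mixSpin l s k.2) (ndot n (mix L X k.1) X) (mix L X k.1))
    (v := fun k => cavCoef n lam (mixSpin l s k.2) (mix L X k.1))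
    (β := fun k => cavShift n lam s (mixSpin l s k.2) Q b)
    (w := fun k => cavCoef n lam (mixSpin l s k.2) b)
    (a := 2 * lam * K ^ 4) (M := lam * K ^ 4) (M' := 3 * lam * K ^ 4)
    (fun k hk => abs_cavShift_le hn hl hs' (hσ k hk) (hr k hk) (hx k hk))
    (fun k hk => sum_cavCoef_sq_le hn hl (hσ k hk) (hx k hk))
    (fun k hk => abs_cavShift_le hn hl hs' (hσ k hk) hQK hbK)
    (fun k hk => sum_cavCoef_sq_le hn hl (hσ k hk) hbK)
    (fun k hk j hj => cav_pair_le hn hl hs' (hσ k hk) (hσ j hj) (hr k hk) (hr j hj) (hx k hk)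
      (hx j hj))
    (fun k hk j hj => cav_pair_le hn hl hs' (hσ k hk) (hσ j hj) (hr k hk) hQK (hx k hk) hbK)
    (fun k hk j hj => cav_pair_le hn hl hs' (hσ k hk) (hσ j hj) hQK hQK hbK hbK)
  refine main.trans ?_
  gcongr
  have hsum : lam * K ^ 2 * gfluct P0 S e L X
      = ∑ q ∈ (confs S n ×ˢ S) ×ˢ (confs S n ×ˢ S),
        gwt P0 S e L X q.1.1 * (P0 {q.1.2}).toReal *
        (gwt P0 S e L X q.2.1 * (P0 {q.2.2}).toReal) * (lam * K ^ 2 *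
          (|ndot n (mix L X q.1.1) (mix L X q.2.1) - Q|
            + 2 * |ndot n (mix L X q.1.1) b - Q| + 3 * |ndot n (mix L X q.1.1) X - Q|
            + |ndot n (mix L X q.2.1) X - Q|)) := by
    rw [sum_prod_gwt hP L X (fun x x' => lam * K ^ 2 * (|ndot n x x' - Q|
      + 2 * |ndot n x b - Q| + 3 * |ndot n x X - Q| + |ndot n x' X - Q|))]
    simp only [gavg_const_mul, gavg_add, gavg_const L X hP he]
    simp only [gfluct]
    ring
  rw [hsum]
  refine Finset.sum_le_sum fun q hq => mul_le_mul_of_nonneg_left ?_ ?_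
  · rw [Finset.mem_product] at hq
    have s1 := hσ _ hq.1
    have s2 := hσ _ hq.2
    have hK : 0 ≤ K := (abs_nonneg _).trans hs'
    simp only [pairExp, cav_pair hn hl]
    rw [← gQ_eq_ndot]
    set σ := mixSpin l s q.1.2
    set σ' := mixSpin l s q.2.2
    have key : ∀ a c t : ℝ, |a| ≤ K → |c| ≤ K → |lam * (a * c * t)| ≤ lam * K ^ 2 * |t| := by
      intro a c t ha hc
      rw [abs_mul, abs_mul, abs_mul, abs_of_nonneg hl]
      calc lam * (|a| * |c| * |t|) ≤ lam * (K * K * |t|) := by gcongr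
        _ = lam * K ^ 2 * |t| := by ring
    have k1 := key s σ (ndot n (mix L X q.1.1) X - Q) hs' s1
    have k2 := key s σ' (ndot n (mix L X q.2.1) X - Q) hs' s2
    have k3 := key σ σ' (ndot n (mix L X q.1.1) (mix L X q.2.1) - Q) s1 s2
    have k4 := key σ σ' (ndot n (mix L X q.1.1) b - Q) s1 s2
    have d1 : lam * s * (σ * ndot n (mix L X q.1.1) X + σ' * ndot n (mix L X q.2.1) X)
        + lam * σ * σ' * ndot n (mix L X q.1.1) (mix L X q.2.1)
        - (lam * s * (σ * Q + σ' * Q) + lam * σ * σ' * Q)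
        = lam * (s * σ * (ndot n (mix L X q.1.1) X - Q))
          + lam * (s * σ' * (ndot n (mix L X q.2.1) X - Q))
          + lam * (σ * σ' * (ndot n (mix L X q.1.1) (mix L X q.2.1) - Q)) := by ring
    have d2 : lam * s * (σ * ndot n (mix L X q.1.1) X + σ' * Q)
        + lam * σ * σ' * ndot n (mix L X q.1.1) b
        - (lam * s * (σ * Q + σ' * Q) + lam * σ * σ' * Q)
        = lam * (s * σ * (ndot n (mix L X q.1.1) X - Q))
          + lam * (σ * σ' * (ndot n (mix L X q.1.1) b - Q)) := by ring
    rw [d1, d2]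
    have t1 := abs_add_three (lam * (s * σ * (ndot n (mix L X q.1.1) X - Q)))
      (lam * (s * σ' * (ndot n (mix L X q.2.1) X - Q)))
      (lam * (σ * σ' * (ndot n (mix L X q.1.1) (mix L X q.2.1) - Q)))
    have t2 := abs_add_le (lam * (s * σ * (ndot n (mix L X q.1.1) X - Q)))
      (lam * (σ * σ' * (ndot n (mix L X q.1.1) b - Q)))
    linarith
  · exact mul_nonneg (mul_nonneg (gwt_nonneg he L X _) ENNReal.toReal_nonneg)
      (mul_nonneg (gwt_nonneg he L X _) ENNReal.toReal_nonneg)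

end Cavity

section CavityMean

variable {n : ℕ} {P0 : Measure ℝ} {S : Finset ℝ} {e : (Fin n → ℝ) → ℝ}

lemma cavV_eq (hP : ∑ s ∈ S, (P0 {s}).toReal = 1) (he : ∀ x, 0 < e x) (lam : ℝ)
    (L : Fin n → Bool) (X : Fin n → ℝ) (l : Bool) (s : ℝ) (z : Fin n → ℝ) :
    cavV P0 S lam e L X l s z = ∑ σ ∈ S, (P0 {σ}).toReal *
      Real.exp (cavShift n lam s (mixSpin l s σ) (gQ P0 S e L X) (gmean P0 S e L X)
        + ∑ i, cavCoef n lam (mixSpin l s σ) (gmean P0 S e L X) i * z i) := by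
  simp only [cavV, mixExp]
  rw [Finset.sum_product]
  simp only [mul_assoc, ← Finset.mul_sum]
  rw [← Finset.sum_mul, sum_gwt hP he, one_mul]

lemma cavShift_gmean (lam s σ : ℝ) (L : Fin n → Bool) (X : Fin n → ℝ) :
    cavShift n lam s σ (gQ P0 S e L X) (gmean P0 S e L X)
      = lam * gQ P0 S e L X * σ * s - lam * σ ^ 2 / 2 * gQ P0 S e L X := by
  rw [cavShift, ← gQ_eq_ndot]
  ring

lemma integral_log_cavV_true (hP : ∑ s ∈ S, (P0 {s}).toReal = 1) (he : ∀ x, 0 < e x) (lam : ℝ)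
    (L : Fin n → Bool) (X : Fin n → ℝ) (s : ℝ) :
    ∫ z, Real.log (cavV P0 S lam e L X true s z) ∂gaussPi (Fin n)
      = s ^ 2 * (lam / 2) * gQ P0 S e L X := by
  simp only [cavV_eq hP he, mixSpin, if_true]
  simp only [← Finset.sum_mul, hP, one_mul, Real.log_exp]
  rw [integral_add (integrable_const _) (integrable_sum_mul_gaussPi _), integral_sum_mul_gaussPi,
    integral_const, cavShift_gmean]
  simp only [probReal_univ, one_smul]
  ring

/-- Expected log-partition function of the scalar Gaussian channel at signal-to-noise ratio
`lam * Q` with signal `s`. -/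
def scalarFree (P0 : Measure ℝ) (S : Finset ℝ) (lam Q s : ℝ) : ℝ :=
  ∫ z0, Real.log (∑ σ ∈ S, (P0 {σ}).toReal *
    Real.exp (Real.sqrt (lam * Q) * σ * z0 + lam * Q * σ * s - lam * σ ^ 2 / 2 * Q)) ∂stdGauss

lemma gQ_nonneg (L : Fin n → Bool) (X : Fin n → ℝ) : 0 ≤ gQ P0 S e L X :=
  mul_nonneg (by positivity) (Finset.sum_nonneg fun i _ => sq_nonneg _)

lemma integral_log_cavV_false (hn : 0 < n) (hP : ∑ s ∈ S, (P0 {s}).toReal = 1)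
    (he : ∀ x, 0 < e x) {lam : ℝ} (hlam : 0 ≤ lam)
    (L : Fin n → Bool) (X : Fin n → ℝ) (s : ℝ) :
    ∫ z, Real.log (cavV P0 S lam e L X false s z) ∂gaussPi (Fin n)
      = scalarFree P0 S lam (gQ P0 S e L X) s := by
  set Q := gQ P0 S e L X with hQ
  have hc : Real.sqrt (lam * Q) ^ 2 = ∑ i, cavCoef n lam 1 (gmean P0 S e L X) i ^ 2 := by
    rw [Real.sq_sqrt (mul_nonneg hlam (gQ_nonneg L X)), sum_cavCoef_sq hn hlam, ← gQ_eq_ndot]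
    ring
  have h := integral_comp_sum_mul_gaussPi (cavCoef n lam 1 (gmean P0 S e L X))
    (Real.sqrt (lam * Q)) hc (f := fun y => Real.log (∑ σ ∈ S, (P0 {σ}).toReal *
      Real.exp (lam * Q * σ * s - lam * σ ^ 2 / 2 * Q + σ * y))) (by fun_prop)
  simp only [cavV_eq hP he, mixSpin, cavShift_gmean, scalarFree, Bool.false_eq_true, if_false]
  have h1 : ∀ σ (z : Fin n → ℝ), ∑ i, cavCoef n lam σ (gmean P0 S e L X) i * z i
      = σ * ∑ i, cavCoef n lam 1 (gmean P0 S e L X) i * z i := by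
    intro σ z
    rw [Finset.mul_sum]
    exact Finset.sum_congr rfl fun i _ => by simp only [cavCoef]; ring
  refine (integral_congr_ae (Eventually.of_forall fun z => ?_)).trans
    (h.trans (integral_congr_ae (Eventually.of_forall fun z => ?_)))
  · refine congrArg Real.log (Finset.sum_congr rfl fun σ _ => ?_)
    rw [h1 σ z]
  · refine congrArg Real.log (Finset.sum_congr rfl fun σ _ => ?_)
    congr 2
    ring

end CavityMean

section Nishimori

variable {n : ℕ} {P0 : Measure ℝ} {S : Finset ℝ}

/-- Log-likelihood of the configuration `x` given the observations `Y`. -/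
def obsLog (n : ℕ) (lam : ℝ) (Y : Fin n × Fin n → ℝ) (x : Fin n → ℝ) : ℝ :=
  ∑ p ∈ pairs n, (Real.sqrt (lam / (n + 1)) * Y p * x p.1 * x p.2
    - lam / (2 * (n + 1)) * (x p.1) ^ 2 * (x p.2) ^ 2)

/-- Likelihood of the configuration `x` given the observations `Y`. -/
def obsLik (n : ℕ) (lam : ℝ) (Y : Fin n × Fin n → ℝ) (x : Fin n → ℝ) : ℝ :=
  Real.exp (obsLog n lam Y x)

/-- The signal part of the observations. -/
def obsSignal (n : ℕ) (lam : ℝ) (X : Fin n → ℝ) (p : Fin n × Fin n) : ℝ :=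
  if p ∈ pairs n then Real.sqrt (lam / (n + 1)) * X p.1 * X p.2 else 0

lemma obsLik_pos (lam : ℝ) (Y : Fin n × Fin n → ℝ) (x : Fin n → ℝ) : 0 < obsLik n lam Y x :=
  Real.exp_pos _

lemma obsLog_eq {lam : ℝ} (hlam : 0 ≤ lam) (Y : Fin n × Fin n → ℝ) (X : Fin n → ℝ) :
    obsLog n lam Y X
      = -((∑ p, obsSignal n lam X p ^ 2) / 2) + ∑ p, obsSignal n lam X p * Y p := by
  have hs : Real.sqrt (lam / (n + 1)) ^ 2 = lam / (n + 1) := Real.sq_sqrt (by positivity)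
  rw [Finset.sum_div, ← Finset.sum_neg_distrib, ← Finset.sum_add_distrib, obsLog]
  rw [← Finset.sum_subset (Finset.subset_univ (pairs n))]
  · refine Finset.sum_congr rfl fun p hp => ?_
    simp only [obsSignal, if_pos hp, mul_pow, hs]
    field_simp
    ring
  · intro p _ hp
    simp [obsSignal, hp]

lemma measurable_obsLik (lam : ℝ) (x : Fin n → ℝ) : Measurable fun Y => obsLik n lam Y x := by
  unfold obsLik obsLog
  fun_prop

lemma integrable_obsLik {lam : ℝ} (hlam : 0 ≤ lam) (X : Fin n → ℝ) :
    Integrable (fun Y => obsLik n lam Y X) (gaussPi (Fin n × Fin n)) := by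
  simp only [obsLik, obsLog_eq hlam]
  exact integrable_exp_gaussPi _ _

lemma integral_obsLik {lam : ℝ} (hlam : 0 ≤ lam) (X : Fin n → ℝ) :
    ∫ Y, obsLik n lam Y X ∂gaussPi (Fin n × Fin n) = 1 := by
  simp only [obsLik, obsLog_eq hlam]
  rw [integral_exp_gaussPi]
  simp

lemma measurable_gavg {lam : ℝ} (L : Fin n → Bool) (X : Fin n → ℝ)
    {f : (Fin n × Fin n → ℝ) → (Fin n → ℝ) → ℝ} (hf : ∀ x, Measurable fun Y => f Y x) :
    Measurable fun Y => gavg P0 S (obsLik n lam Y) L X (f Y) := by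
  unfold gavg gden
  refine Measurable.div (Finset.measurable_fun_sum _ fun x _ => ?_)
    (Finset.measurable_fun_sum _ fun x _ => ?_)
  · exact ((hf _).const_mul _).mul (measurable_obsLik lam _)
  · exact (measurable_obsLik lam _).const_mul _

lemma measurable_gmean {lam : ℝ} (L : Fin n → Bool) (X : Fin n → ℝ) (i : Fin n) :
    Measurable fun Y => gmean P0 S (obsLik n lam Y) L X i :=
  measurable_gavg L X fun _ => measurable_const

lemma measurable_gQ {lam : ℝ} (L : Fin n → Bool) (X : Fin n → ℝ) :
    Measurable fun Y => gQ P0 S (obsLik n lam Y) L X :=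
  (Finset.measurable_fun_sum _ fun i _ => (measurable_gmean L X i).pow_const 2).const_mul _

lemma measurable_gfluct {lam : ℝ} (L : Fin n → Bool) (X : Fin n → ℝ) :
    Measurable fun Y => gfluct P0 S (obsLik n lam Y) L X := by
  have hQ := measurable_gQ (P0 := P0) (S := S) (lam := lam) L X
  have habs : ∀ {f g : (Fin n × Fin n → ℝ) → ℝ}, Measurable f → Measurable g →
      Measurable fun Y => |f Y - g Y| := fun hf hg =>
    continuous_abs.measurable.comp (hf.sub hg)
  refine ((measurable_gavg L X fun x => measurable_gavg L X fun x' =>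
    habs measurable_const hQ).add ((measurable_gavg L X fun x => habs ?_ hQ).const_mul 2)).add
    ((measurable_gavg L X fun x => habs measurable_const hQ).const_mul 4)
  exact (Finset.measurable_fun_sum _ fun i _ => (measurable_gmean L X i).const_mul _).const_mul _

lemma abs_gfluct_le {e : (Fin n → ℝ) → ℝ} (hn : 0 < n) (hP : ∑ s ∈ S, (P0 {s}).toReal = 1)
    (he : ∀ x, 0 < e x) {K : ℝ} (hSK : ∀ x ∈ S, |x| ≤ K) (L : Fin n → Bool) {X : Fin n → ℝ}
    (hX : X ∈ confs S n) : |gfluct P0 S e L X| ≤ 14 * K ^ 2 := by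
  have hb := abs_gmean_le hP he hSK L hX
  have hQ := abs_gQ_le hn hP he hSK L hX
  have hconf : ∀ x ∈ confs S n, ∀ i, |x i| ≤ K := fun x hx i =>
    hSK _ (Fintype.mem_piFinset.1 hx i)
  have key : ∀ u w : Fin n → ℝ, (∀ i, |u i| ≤ K) → (∀ i, |w i| ≤ K) →
      |(|ndot n u w - gQ P0 S e L X|)| ≤ 2 * K ^ 2 := by
    intro u w hu hw
    rw [abs_abs]
    have := abs_sub (ndot n u w) (gQ P0 S e L X)
    linarith [abs_ndot_le hn hu hw]
  have h1 := abs_gavg_le hP he L hX (f := fun x => gavg P0 S e L X fun x' =>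
    |ndot n x x' - gQ P0 S e L X|) (fun x hx => abs_gavg_le hP he L hX
      fun x' hx' => key x x' (hconf x hx) (hconf x' hx'))
  have h2 := abs_gavg_le hP he L hX (f := fun x => |ndot n x (gmean P0 S e L X) - gQ P0 S e L X|)
    (fun x hx => key x _ (hconf x hx) hb)
  have h3 := abs_gavg_le hP he L hX (f := fun x => |ndot n x X - gQ P0 S e L X|)
    (fun x hx => key x _ (hconf x hx) (hconf X hX))
  rw [abs_le] at h1 h2 h3 ⊢
  unfold gfluct
  constructor <;> linarith

lemma integrable_obsLik_mul {lam : ℝ} (hlam : 0 ≤ lam) (X : Fin n → ℝ)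
    {F : (Fin n × Fin n → ℝ) → ℝ} (hF : Measurable F) {B : ℝ} (hB : ∀ Y, |F Y| ≤ B) (w : ℝ) :
    Integrable (fun Y => w * obsLik n lam Y X * F Y) (gaussPi (Fin n × Fin n)) := by
  refine (((integrable_obsLik hlam X).const_mul w).mul_bdd (c := B) hF.aestronglyMeasurable
    (Eventually.of_forall hB))

/-- Change of measure from the noise to the observations. -/
lemma sum_weight_integral_signal {lam : ℝ} (hlam : 0 ≤ lam)
    (F : (Fin n × Fin n → ℝ) → (Fin n → ℝ) → ℝ) (hF : ∀ X, Measurable fun Y => F Y X) {B : ℝ}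
    (hB : ∀ X ∈ confs S n, ∀ Y, |F Y X| ≤ B) :
    ∑ X ∈ confs S n, weight P0 n X * ∫ Z, F (Z + obsSignal n lam X) X ∂gaussPi (Fin n × Fin n)
      = ∫ Y, ∑ X ∈ confs S n, weight P0 n X * obsLik n lam Y X * F Y X
          ∂gaussPi (Fin n × Fin n) := by
  rw [integral_finsetSum _ fun X hX => integrable_obsLik_mul hlam X (hF X) (hB X hX) _]
  refine Finset.sum_congr rfl fun X _ => ?_
  rw [integral_gaussPi_add (obsSignal n lam X) fun Y => F Y X]
  simp only [mul_assoc]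
  rw [integral_const_mul]
  simp only [obsLik, obsLog_eq hlam]

end Nishimori

section Overlap

variable {n : ℕ} {P0 : Measure ℝ} {S : Finset ℝ}

/-- Expected overlap fluctuation when the coordinates in `L` are revealed. -/
def fluctMean (P0 : Measure ℝ) (S : Finset ℝ) (lam : ℝ) (L : Fin n → Bool) : ℝ :=
  ∑ X ∈ confs S n, weight P0 n X *
    ∫ Z, gfluct P0 S (obsLik n lam (Z + obsSignal n lam X)) L X ∂gaussPi (Fin n × Fin n)

/-- Expected squared norm of the posterior mean. -/
def meanEnergy (P0 : Measure ℝ) (S : Finset ℝ) (lam : ℝ) (L : Fin n → Bool) : ℝ :=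
  ∫ Y, ∑ X ∈ confs S n, weight P0 n X * obsLik n lam Y X *
    ∑ i, gmean P0 S (obsLik n lam Y) L X i ^ 2 ∂gaussPi (Fin n × Fin n)

/-- Expected squared posterior covariances with the coordinate `j`. -/
def covEnergy (P0 : Measure ℝ) (S : Finset ℝ) (lam : ℝ) (j : Fin n) (L : Fin n → Bool) : ℝ :=
  ∫ Y, ∑ X ∈ confs S n, weight P0 n X * obsLik n lam Y X *
    ∑ i, gcov P0 S (obsLik n lam Y) L X i j ^ 2 ∂gaussPi (Fin n × Fin n)

lemma integrable_sum_obsLik_mul {lam : ℝ} (hlam : 0 ≤ lam)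
    {F : (Fin n × Fin n → ℝ) → (Fin n → ℝ) → ℝ} (hF : ∀ X, Measurable fun Y => F Y X) {B : ℝ}
    (hB : ∀ X ∈ confs S n, ∀ Y, |F Y X| ≤ B) :
    Integrable (fun Y => ∑ X ∈ confs S n, weight P0 n X * obsLik n lam Y X * F Y X)
      (gaussPi (Fin n × Fin n)) :=
  integrable_finsetSum _ fun X hX => integrable_obsLik_mul hlam X (hF X) (hB X hX) _

lemma integral_sum_obsLik (hP : ∑ s ∈ S, (P0 {s}).toReal = 1) {lam : ℝ} (hlam : 0 ≤ lam) :
    ∫ Y, ∑ X ∈ confs S n, weight P0 n X * obsLik n lam Y X ∂gaussPi (Fin n × Fin n) = 1 := by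
  rw [integral_finsetSum _ fun X _ => (integrable_obsLik hlam X).const_mul _]
  simp only [integral_const_mul, integral_obsLik hlam, mul_one, sum_weight hP]

lemma integrable_sum_obsLik {lam : ℝ} (hlam : 0 ≤ lam) :
    Integrable (fun Y => ∑ X ∈ confs S n, weight P0 n X * obsLik n lam Y X)
      (gaussPi (Fin n × Fin n)) :=
  integrable_finsetSum _ fun X _ => (integrable_obsLik hlam X).const_mul _

lemma measurable_gcov {lam : ℝ} (L : Fin n → Bool) (X : Fin n → ℝ) (i j : Fin n) :
    Measurable fun Y => gcov P0 S (obsLik n lam Y) L X i j := by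
  have h1 := measurable_gavg (P0 := P0) (S := S) (lam := lam) L X
    (f := fun _ x => x i * x j) fun _ => measurable_const
  have h2 := measurable_gmean (P0 := P0) (S := S) (lam := lam) L X
  exact h1.sub ((h2 i).mul (h2 j))

lemma abs_gcov_le {e : (Fin n → ℝ) → ℝ} (hP : ∑ s ∈ S, (P0 {s}).toReal = 1)
    (he : ∀ x, 0 < e x) {K : ℝ} (hSK : ∀ x ∈ S, |x| ≤ K) (L : Fin n → Bool) {X : Fin n → ℝ}
    (hX : X ∈ confs S n) (i j : Fin n) : |gcov P0 S e L X i j| ≤ 2 * K ^ 2 := by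
  have hconf : ∀ x ∈ confs S n, ∀ i, |x i| ≤ K := fun x hx i =>
    hSK _ (Fintype.mem_piFinset.1 hx i)
  have key : ∀ a b : ℝ, |a| ≤ K → |b| ≤ K → |a * b| ≤ K ^ 2 := by
    intro a b ha hb
    rw [abs_mul, sq]
    exact mul_le_mul ha hb (abs_nonneg _) ((abs_nonneg _).trans ha)
  have h1 := abs_gavg_le hP he L hX (f := fun x => x i * x j)
    fun x hx => key _ _ (hconf x hx i) (hconf x hx j)
  have h2 := key _ _ (abs_gmean_le hP he hSK L hX i) (abs_gmean_le hP he hSK L hX j)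
  have h3 := abs_sub (gavg P0 S e L X fun x => x i * x j)
    (gmean P0 S e L X i * gmean P0 S e L X j)
  unfold gcov
  unfold gmean at h2 h3
  linarith

lemma abs_sum_sq_le {f : Fin n → ℝ} {B : ℝ} (hf : ∀ i, |f i| ≤ B) :
    |∑ i, f i ^ 2| ≤ n * B ^ 2 := by
  rw [abs_of_nonneg (Finset.sum_nonneg fun i _ => sq_nonneg _)]
  calc ∑ i, f i ^ 2 ≤ ∑ _i : Fin n, B ^ 2 := Finset.sum_le_sum fun i _ =>
        sq_le_sq' (by linarith [(abs_le.1 (hf i)).1]) (abs_le.1 (hf i)).2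
    _ = n * B ^ 2 := by simp

lemma integrable_covEnergy (hP : ∑ s ∈ S, (P0 {s}).toReal = 1) {lam : ℝ} (hlam : 0 ≤ lam) {K : ℝ}
    (hSK : ∀ x ∈ S, |x| ≤ K) (j : Fin n) (L : Fin n → Bool) :
    Integrable (fun Y => ∑ X ∈ confs S n, weight P0 n X * obsLik n lam Y X *
      ∑ i, gcov P0 S (obsLik n lam Y) L X i j ^ 2) (gaussPi (Fin n × Fin n)) :=
  integrable_sum_obsLik_mul hlam
    (fun X => Finset.measurable_fun_sum _ fun i _ => (measurable_gcov L X i j).pow_const 2)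
    (fun _ hX Y => abs_sum_sq_le fun i => abs_gcov_le hP (obsLik_pos lam Y) hSK L hX i j)

lemma integrable_meanEnergy (hP : ∑ s ∈ S, (P0 {s}).toReal = 1) {lam : ℝ} (hlam : 0 ≤ lam) {K : ℝ}
    (hSK : ∀ x ∈ S, |x| ≤ K) (L : Fin n → Bool) :
    Integrable (fun Y => ∑ X ∈ confs S n, weight P0 n X * obsLik n lam Y X *
      ∑ i, gmean P0 S (obsLik n lam Y) L X i ^ 2) (gaussPi (Fin n × Fin n)) :=
  integrable_sum_obsLik_mul hlam
    (fun X => Finset.measurable_fun_sum _ fun i _ => (measurable_gmean L X i).pow_const 2)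
    (fun _ hX Y => abs_sum_sq_le fun i => abs_gmean_le hP (obsLik_pos lam Y) hSK L hX i)

lemma weight_obsLik_nonneg (lam : ℝ) (Y : Fin n × Fin n → ℝ) (X : Fin n → ℝ) :
    0 ≤ weight P0 n X * obsLik n lam Y X :=
  mul_nonneg (weight_nonneg P0 X) (obsLik_pos lam Y X).le

lemma covEnergy_nonneg (lam : ℝ) (j : Fin n) (L : Fin n → Bool) : 0 ≤ covEnergy P0 S lam j L :=
  integral_nonneg fun Y => Finset.sum_nonneg fun X _ =>
    mul_nonneg (weight_obsLik_nonneg lam Y X) (Finset.sum_nonneg fun _ _ => sq_nonneg _)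

lemma meanEnergy_nonneg (lam : ℝ) (L : Fin n → Bool) : 0 ≤ meanEnergy P0 S lam L :=
  integral_nonneg fun Y => Finset.sum_nonneg fun X _ =>
    mul_nonneg (weight_obsLik_nonneg lam Y X) (Finset.sum_nonneg fun _ _ => sq_nonneg _)

lemma meanEnergy_le (hP : ∑ s ∈ S, (P0 {s}).toReal = 1) {lam : ℝ} (hlam : 0 ≤ lam) {K : ℝ}
    (hSK : ∀ x ∈ S, |x| ≤ K) (L : Fin n → Bool) : meanEnergy P0 S lam L ≤ n * K ^ 2 := by
  refine (integral_mono (integrable_meanEnergy hP hlam hSK L)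
    ((integrable_sum_obsLik (n := n) (P0 := P0) (S := S) hlam).mul_const (n * K ^ 2)) fun Y => ?_).trans_eq ?_
  · simp only
    rw [Finset.sum_mul]
    exact Finset.sum_le_sum fun X hX => mul_le_mul_of_nonneg_left ((le_abs_self _).trans
      (abs_sum_sq_le fun i => abs_gmean_le hP (obsLik_pos lam Y) hSK L hX i))
      (weight_obsLik_nonneg lam Y X)
  · rw [integral_mul_const, integral_sum_obsLik hP hlam, one_mul]

lemma covEnergy_le (hP : ∑ s ∈ S, (P0 {s}).toReal = 1) {lam : ℝ} (hlam : 0 ≤ lam) {K : ℝ}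
    (hSK : ∀ x ∈ S, |x| ≤ K) (j : Fin n) (L : Fin n → Bool) :
    covEnergy P0 S lam j L
      ≤ K ^ 2 * (meanEnergy P0 S lam (Function.update L j true) - meanEnergy P0 S lam L) := by
  unfold meanEnergy
  rw [← integral_sub (integrable_meanEnergy hP hlam hSK _) (integrable_meanEnergy hP hlam hSK L),
    ← integral_const_mul]
  refine integral_mono (integrable_covEnergy hP hlam hSK j L)
    (((integrable_meanEnergy hP hlam hSK _).sub (integrable_meanEnergy hP hlam hSK L)).const_mul _)
    fun Y => ?_
  simp only [Finset.mul_sum (Finset.univ : Finset (Fin n))]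
  rw [Finset.sum_comm, Finset.sum_comm (s := confs S n), Finset.sum_comm (s := confs S n),
    ← Finset.sum_sub_distrib, Finset.mul_sum]
  exact Finset.sum_le_sum fun i _ => sum_gcov_sq_le hP (obsLik_pos lam Y) hSK L i j

lemma fluctMean_le (hP : ∑ s ∈ S, (P0 {s}).toReal = 1) {lam : ℝ} (hlam : 0 ≤ lam) {K : ℝ}
    (hSK : ∀ x ∈ S, |x| ≤ K) {η ζ : ℝ} (hη : 0 < η) (hζ : 0 < ζ) (hn : 0 < n)
    (L : Fin n → Bool) :
    fluctMean P0 S lam L ≤ 7 / 2 * (η + K ^ 2 / η * (ζ + 1 / ζ * (1 / n : ℝ) ^ 2 *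
      ∑ j, covEnergy P0 S lam j L)) := by
  have hA := integrable_sum_obsLik (n := n) (P0 := P0) (S := S) hlam
  have hB : Integrable (fun Y => ∑ j, ∑ X ∈ confs S n, weight P0 n X * obsLik n lam Y X *
      ∑ i, gcov P0 S (obsLik n lam Y) L X i j ^ 2) (gaussPi (Fin n × Fin n)) :=
    integrable_finsetSum _ fun j _ => integrable_covEnergy hP hlam hSK j L
  have hF := fun (X : Fin n → ℝ) => measurable_gfluct (P0 := P0) (S := S) (lam := lam) L X
  have hFB := fun (X : Fin n → ℝ) (hX : X ∈ confs S n) (Y : Fin n × Fin n → ℝ) =>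
    abs_gfluct_le hn hP (obsLik_pos lam Y) hSK L hX
  rw [fluctMean, sum_weight_integral_signal hlam
    (fun Y X => gfluct P0 S (obsLik n lam Y) L X) hF hFB]
  refine (integral_mono (integrable_sum_obsLik_mul hlam hF hFB)
    (((hA.const_mul η).add (((hA.const_mul ζ).add (hB.const_mul (1 / ζ * (1 / n : ℝ) ^ 2))).const_mul
      (K ^ 2 / η))).const_mul (7 / 2)) fun Y => ?_).trans_eq ?_
  · refine (sum_gfluct_le hP (obsLik_pos lam Y) hSK hη hζ hn L).trans_eq ?_
    have : ∑ i, ∑ j, ∑ X ∈ confs S n, weight P0 n X * obsLik n lam Y X *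
          gcov P0 S (obsLik n lam Y) L X i j ^ 2
        = ∑ j, ∑ X ∈ confs S n, weight P0 n X * obsLik n lam Y X *
          ∑ i, gcov P0 S (obsLik n lam Y) L X i j ^ 2 := by
      rw [Finset.sum_comm]
      refine Finset.sum_congr rfl fun j _ => ?_
      rw [Finset.sum_comm]
      simp only [Finset.mul_sum]
    rw [this]
    rfl
  · rw [integral_const_mul]
    congr 1
    have e1 := integral_add (hA.const_mul η) (((hA.const_mul ζ).add
      (hB.const_mul (1 / ζ * (1 / n : ℝ) ^ 2))).const_mul (K ^ 2 / η))
    have e2 := integral_add (hA.const_mul ζ) (hB.const_mul (1 / ζ * (1 / n : ℝ) ^ 2))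
    have e3 := integral_finsetSum (μ := gaussPi (Fin n × Fin n)) Finset.univ
      fun j _ => integrable_covEnergy hP hlam hSK j L
    simp only [integral_const_mul, integral_sum_obsLik hP hlam, mul_one, Pi.add_apply]
      at e1 e2 e3 ⊢
    rw [e1, e2, e3]
    rfl

end Overlap

section Averaging

lemma eq_sum_smul_dirac {α : Type*} [MeasurableSpace α] [MeasurableSingletonClass α]
    (μ : Measure α) (T : Finset α) (hT : μ (T : Set α)ᶜ = 0) :
    μ = Measure.sum fun x : T => μ {(x : α)} • Measure.dirac (x : α) := by
  have h : (T : Set α) = ⋃ x ∈ T, {x} := by ext; simp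
  conv_lhs => rw [← Measure.restrict_eq_self_of_ae_mem (show ∀ᵐ x ∂μ, x ∈ (T : Set α) from hT), h]
  rw [Measure.restrict_biUnion_finset
    (fun x _ y _ hxy => Set.disjoint_singleton.2 hxy) fun _ => measurableSet_singleton _]
  simp only [Measure.restrict_singleton]

/-- Integration against the product of a finitely supported measure and another measure. -/
lemma integral_prod_of_support {α β : Type*} [MeasurableSpace α] [MeasurableSingletonClass α]
    [MeasurableSpace β] (μ : Measure α) [IsFiniteMeasure μ] (ν : Measure β) [SFinite ν]
    (T : Finset α) (hT : μ (T : Set α)ᶜ = 0) {F : α × β → ℝ}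
    (hF : ∀ x ∈ T, Integrable (fun y => F (x, y)) ν) :
    Integrable F (μ.prod ν) ∧
      ∫ p, F p ∂μ.prod ν = ∑ x ∈ T, (μ {x}).toReal * ∫ y, F (x, y) ∂ν := by
  have hμ : μ.prod ν = ∑ x : T, μ {(x : α)} • ν.map (Prod.mk (x : α)) := by
    conv_lhs => rw [eq_sum_smul_dirac μ T hT]
    rw [Measure.prod_sum_left, Measure.sum_fintype]
    simp only [Measure.prod_smul_left, Measure.dirac_prod]
  have hi : ∀ x ∈ (Finset.univ : Finset T),
      Integrable F (μ {(x : α)} • ν.map (Prod.mk (x : α))) := fun x _ =>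
    ((measurableEmbedding_prodMk_left (x : α)).integrable_map_iff.2 (hF x x.2)).smul_measure
      (measure_ne_top _ _)
  rw [hμ]
  refine ⟨integrable_finsetSum_measure.2 hi, ?_⟩
  rw [integral_finsetSum_measure hi,
    ← Finset.sum_coe_sort T fun x => (μ {x}).toReal * ∫ y, F (x, y) ∂ν]
  refine Finset.sum_congr rfl fun x _ => ?_
  rw [integral_smul_measure, (measurableEmbedding_prodMk_left (x : α)).integral_map, smul_eq_mul]

lemma measurePreserving_gaussPi_precomp {ι κ : Type*} [Fintype ι] [Fintype κ] {g : κ → ι}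
    (hg : Function.Injective g) :
    MeasurePreserving (fun z : ι → ℝ => fun k => z (g k)) (gaussPi ι) (gaussPi κ) := by
  refine ⟨by fun_prop, ?_⟩
  have h : iIndepFun (fun i (z : ι → ℝ) => z i) (gaussPi ι) :=
    iIndepFun_pi (X := fun _ => id) fun _ => aemeasurable_id
  rw [(iIndepFun_iff_map_fun_eq_pi_map fun k => (measurable_pi_apply (g k)).aemeasurable).1
    (h.precomp hg)]
  congr 1
  funext k
  exact (measurePreserving_eval (fun _ : ι => stdGauss) (g k)).map_eq

/-- The coupling noise and the cavity noise are independent standard Gaussian families. -/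
lemma measurePreserving_cavity_noise (n : ℕ) :
    MeasurePreserving (fun Z : Fin (n + 1) × Fin (n + 1) → ℝ =>
        ((fun p : Fin n × Fin n => Z (p.1.castSucc, p.2.castSucc)),
          fun i : Fin n => Z (i.castSucc, Fin.last n)))
      (gaussPi (Fin (n + 1) × Fin (n + 1))) ((gaussPi (Fin n × Fin n)).prod (gaussPi (Fin n))) := by
  let g : (Fin n × Fin n) ⊕ Fin n → Fin (n + 1) × Fin (n + 1) :=
    Sum.elim (fun p => (p.1.castSucc, p.2.castSucc)) fun i => (i.castSucc, Fin.last n)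
  have hg : Function.Injective g := by
    rintro (⟨a, b⟩ | a) (⟨c, d⟩ | c) h
    · simpa [g] using h
    · exact absurd (congrArg Prod.snd h) (Fin.castSucc_lt_last b).ne
    · exact absurd (congrArg Prod.snd h).symm (Fin.castSucc_lt_last d).ne
    · simpa [g] using h
  exact (measurePreserving_sumPiEquivProdPi fun _ => stdGauss).comp
    (measurePreserving_gaussPi_precomp hg)

lemma isProbabilityMeasure_bern {ε : ℝ} (h0 : 0 ≤ ε) (h1 : ε ≤ 1) :
    IsProbabilityMeasure (bern ε) := by
  constructor
  rw [bern, Measure.add_apply, Measure.smul_apply, Measure.smul_apply, smul_eq_mul, smul_eq_mul,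
    measure_univ, measure_univ, mul_one, mul_one, ← ENNReal.ofReal_add h0 (by linarith)]
  simp

lemma bern_singleton {ε : ℝ} (h0 : 0 ≤ ε) (h1 : ε ≤ 1) (l : Bool) :
    (bern ε {l}).toReal = if l then ε else 1 - ε := by
  have h1' : 0 ≤ 1 - ε := by linarith
  rw [bern, Measure.add_apply, Measure.smul_apply, Measure.smul_apply]
  cases l <;> simp [h0, h1']

/-- The part of the sample relevant to the cavity computation. -/
def cavProj (n : ℕ) (ω : CavΩ n) :
    ((Fin (n + 1) → ℝ) × (Fin (n + 1) → Bool)) × ((Fin n × Fin n → ℝ) × (Fin n → ℝ)) :=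
  ((ω.1, ω.2.2.1), ((fun p => ω.2.1 (p.1.castSucc, p.2.castSucc)),
    fun i => ω.2.1 (i.castSucc, Fin.last n)))

lemma measurePreserving_cavProj (P0 : Measure ℝ) [IsProbabilityMeasure P0] (n : ℕ) {ε : ℝ}
    (h0 : 0 ≤ ε) (h1 : ε ≤ 1) :
    MeasurePreserving (cavProj n) (cavMeas P0 n ε)
      (((Measure.pi fun _ : Fin (n + 1) => P0).prod (Measure.pi fun _ : Fin (n + 1) => bern ε)).prod
        ((gaussPi (Fin n × Fin n)).prod (gaussPi (Fin n)))) := by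
  have := isProbabilityMeasure_bern h0 h1
  have a := ((measurePreserving_cavity_noise n).prod
    (measurePreserving_fst (μ := Measure.pi fun _ : Fin (n + 1) => bern ε)
      (ν := (gaussPi (Fin (n + 1))).prod (gaussPi (Fin (n + 1) × Fin (n + 1))))))
  have b := (MeasurePreserving.id (Measure.pi fun _ : Fin (n + 1) => P0)).prod
    (Measure.measurePreserving_swap.comp a)
  exact ((measurePreserving_prodAssoc _ _ _).symm _).comp b

lemma sum_weight_succ (P0 : Measure ℝ) (S : Finset ℝ) (n : ℕ) (f : (Fin n → ℝ) → ℝ → ℝ) :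
    ∑ X ∈ confs S (n + 1), weight P0 (n + 1) X * f (fun i => X i.castSucc) (X (Fin.last n))
      = ∑ X ∈ confs S n, weight P0 n X * ∑ s ∈ S, (P0 {s}).toReal * f X s := by
  simp only [Finset.mul_sum]
  rw [Finset.sum_sigma']
  refine Finset.sum_bij' (fun X _ => ⟨fun i => X i.castSucc, X (Fin.last n)⟩)
    (fun p _ => Fin.snoc (α := fun _ => ℝ) p.1 p.2) ?_ ?_ ?_ ?_ ?_
  · intro X hX
    have := Fintype.mem_piFinset.1 hX
    exact Finset.mem_sigma.2 ⟨Fintype.mem_piFinset.2 fun i => this _, this _⟩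
  · rintro ⟨X, s⟩ h
    obtain ⟨hX, hs⟩ := Finset.mem_sigma.1 h
    refine Fintype.mem_piFinset.2 fun i => ?_
    refine Fin.lastCases ?_ (fun j => ?_) i
    · simpa using hs
    · simpa using Fintype.mem_piFinset.1 hX j
  · intro X _
    exact Fin.snoc_init_self (α := fun _ => ℝ) X
  · rintro ⟨X, s⟩ _
    simp
  · intro X _
    rw [weight, Fin.prod_univ_castSucc, weight]
    ring

lemma sum_bernWt_succ (n : ℕ) (ε : ℝ) (f : (Fin n → Bool) → Bool → ℝ) :
    ∑ L, bernWt ε L * f (fun i : Fin n => L i.castSucc) (L (Fin.last n))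
      = ∑ L, bernWt ε L * (ε * f L true + (1 - ε) * f L false) := by
  rw [← (Fin.snocEquiv fun _ => Bool).sum_comp, Fintype.sum_prod_type, Finset.sum_comm]
  refine Finset.sum_congr rfl fun L _ => ?_
  rw [Fintype.sum_bool]
  simp only [bernWt, Fin.prod_univ_castSucc, Fin.snocEquiv_apply, Fin.snoc_castSucc, Fin.snoc_last]
  simp
  ring

/-- Expectation of a function of the relevant part of the sample. -/
lemma integral_cavMeas (P0 : Measure ℝ) [IsProbabilityMeasure P0] (S : Finset ℝ)
    (hsupp : P0 ((↑S : Set ℝ)ᶜ) = 0) (n : ℕ) {ε : ℝ} (h0 : 0 ≤ ε) (h1 : ε ≤ 1)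
    (Φ : (Fin n → ℝ) → (Fin n → Bool) → ℝ → Bool → (Fin n × Fin n → ℝ) × (Fin n → ℝ) → ℝ)
    (hΦ : ∀ X ∈ confs S n, ∀ L, ∀ s ∈ S, ∀ l,
      Integrable (Φ X L s l) ((gaussPi (Fin n × Fin n)).prod (gaussPi (Fin n)))) :
    ∫ ω, Φ (fun i => ω.1 i.castSucc) (fun i => ω.2.2.1 i.castSucc) (ω.1 (Fin.last n))
        (ω.2.2.1 (Fin.last n)) (cavProj n ω).2 ∂cavMeas P0 n ε
      = ∑ X ∈ confs S n, weight P0 n X * ∑ s ∈ S, (P0 {s}).toReal * ∑ L, bernWt ε L *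
        (ε * (∫ z, Φ X L s true z ∂(gaussPi (Fin n × Fin n)).prod (gaussPi (Fin n)))
          + (1 - ε) * ∫ z, Φ X L s false z ∂(gaussPi (Fin n × Fin n)).prod (gaussPi (Fin n))) := by
  have := isProbabilityMeasure_bern h0 h1
  set μ := (Measure.pi fun _ : Fin (n + 1) => P0).prod (Measure.pi fun _ : Fin (n + 1) => bern ε)
    with hμ
  set F : ((Fin (n + 1) → ℝ) × (Fin (n + 1) → Bool)) × ((Fin n × Fin n → ℝ) × (Fin n → ℝ)) → ℝ :=
    fun q => Φ (fun i => q.1.1 i.castSucc) (fun i => q.1.2 i.castSucc) (q.1.1 (Fin.last n))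
      (q.1.2 (Fin.last n)) q.2 with hF
  have hT : μ (((confs S (n + 1) ×ˢ Finset.univ :
      Finset ((Fin (n + 1) → ℝ) × (Fin (n + 1) → Bool))) : Set _))ᶜ = 0 := by
    have hX : ∀ᵐ X ∂(Measure.pi fun _ : Fin (n + 1) => P0), X ∈ confs S (n + 1) := by
      have : ∀ i : Fin (n + 1), ∀ᵐ X ∂(Measure.pi fun _ : Fin (n + 1) => P0), X i ∈ S := fun i =>
        (measurePreserving_eval (fun _ : Fin (n + 1) => P0) i).quasiMeasurePreserving.ae
          (show ∀ᵐ x ∂P0, x ∈ S from hsupp)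
      filter_upwards [ae_all_iff.2 this] with X hX using Fintype.mem_piFinset.2 hX
    have h2 : ∀ᵐ q ∂μ, q.1 ∈ confs S (n + 1) :=
      measurePreserving_fst.quasiMeasurePreserving.ae hX
    have h3 : ∀ᵐ q ∂μ, q ∈ (((confs S (n + 1) ×ˢ Finset.univ :
      Finset ((Fin (n + 1) → ℝ) × (Fin (n + 1) → Bool))) : Set _)) := by
      filter_upwards [h2] with q hq
      simpa using hq
    exact h3
  obtain ⟨hint, hval⟩ := integral_prod_of_support μ
    ((gaussPi (Fin n × Fin n)).prod (gaussPi (Fin n))) _ hT (F := F) fun q hq =>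
      hΦ (fun i => q.1 i.castSucc) (Fintype.mem_piFinset.2 fun i =>
          Fintype.mem_piFinset.1 (Finset.mem_product.1 hq).1 i.castSucc)
        (fun i => q.2 i.castSucc) (q.1 (Fin.last n))
        (Fintype.mem_piFinset.1 (Finset.mem_product.1 hq).1 (Fin.last n)) (q.2 (Fin.last n))
  have hρ := measurePreserving_cavProj P0 n h0 h1
  have hmap := integral_map hρ.measurable.aemeasurable
    (hρ.map_eq.symm ▸ hint.aestronglyMeasurable)
  rw [hρ.map_eq, hval] at hmap
  refine hmap.symm.trans ?_
  have hw : ∀ q : (Fin (n + 1) → ℝ) × (Fin (n + 1) → Bool),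
      (μ {q}).toReal = weight P0 (n + 1) q.1 * bernWt ε q.2 := by
    rintro ⟨X, L⟩
    rw [hμ, ← Set.singleton_prod_singleton, Measure.prod_prod, Measure.pi_singleton,
      Measure.pi_singleton, ENNReal.toReal_mul, ENNReal.toReal_prod, ENNReal.toReal_prod]
    simp only [bern_singleton h0 h1]
    rfl
  rw [Finset.sum_product]
  simp only [hw, hF, mul_assoc, ← Finset.mul_sum]
  set G := (gaussPi (Fin n × Fin n)).prod (gaussPi (Fin n))
  rw [sum_weight_succ P0 S n (fun X s => ∑ L, bernWt ε L *
    ∫ z, Φ X (fun i : Fin n => L i.castSucc) s (L (Fin.last n)) z ∂G)]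
  refine Finset.sum_congr rfl fun X _ => ?_
  congr 1
  refine Finset.sum_congr rfl fun s _ => ?_
  congr 1
  exact sum_bernWt_succ n ε fun L l => ∫ z, Φ X L s l z ∂G

end Averaging

section CavityComparison

variable {n : ℕ} {P0 : Measure ℝ} {S : Finset ℝ}

/-- The observations generated by the signal `X` and the noise `Z`. -/
abbrev noisyObs (n : ℕ) (lam : ℝ) (X : Fin n → ℝ) (Z : Fin n × Fin n → ℝ) : Fin n × Fin n → ℝ :=
  Z + obsSignal n lam X

lemma Hcav_eq {lam : ℝ} (hlam : 0 ≤ lam) (ω : CavΩ n) (x : Fin n → ℝ) :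
    Hcav n lam ω x
      = obsLog n lam (noisyObs n lam (fun i => ω.1 i.castSucc) (cavProj n ω).2.1) x := by
  have hs : Real.sqrt (lam / (n + 1)) * Real.sqrt (lam / (n + 1)) = lam / (n + 1) :=
    Real.mul_self_sqrt (by positivity)
  refine Finset.sum_congr rfl fun p hp => ?_
  simp only [noisyObs, Pi.add_apply, obsSignal, if_pos hp, cavProj]
  linear_combination
    (-(ω.1 p.1.castSucc * ω.1 p.2.castSucc * x p.1 * x p.2)) * hs

lemma gibbs_eq {lam : ℝ} (hlam : 0 ≤ lam) (ω : CavΩ n) (f : (Fin n → ℝ) → ℝ) :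
    gibbs P0 S n lam ω f
      = gavg P0 S (obsLik n lam (noisyObs n lam (fun i => ω.1 i.castSucc) (cavProj n ω).2.1))
        (fun i => ω.2.2.1 i.castSucc) (fun i => ω.1 i.castSucc) f := by
  simp only [gibbs, Hcav_eq hlam]
  rfl

lemma Qoverlap_eq {lam : ℝ} (hlam : 0 ≤ lam) (ω : CavΩ n) :
    Qoverlap P0 S n lam ω
      = gQ P0 S (obsLik n lam (noisyObs n lam (fun i => ω.1 i.castSucc) (cavProj n ω).2.1))
        (fun i => ω.2.2.1 i.castSucc) (fun i => ω.1 i.castSucc) := by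
  simp only [Qoverlap, bcoef, gibbs_eq hlam]
  rfl

lemma Ucav_eq {lam : ℝ} (hlam : 0 ≤ lam) (ω : CavΩ n) :
    Ucav P0 S n lam ω
      = cavU P0 S lam
        (obsLik n lam (noisyObs n lam (fun i => ω.1 i.castSucc) (cavProj n ω).2.1))
        (fun i => ω.2.2.1 i.castSucc) (fun i => ω.1 i.castSucc) (ω.2.2.1 (Fin.last n))
        (ω.1 (Fin.last n)) (cavProj n ω).2.2 := by
  rw [Ucav, gibbs_eq hlam, gavg_eq_sum, cavU, mixExp, Finset.sum_product]
  refine Finset.sum_congr rfl fun x _ => ?_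
  rw [fzs, Finset.mul_sum]
  refine Finset.sum_congr rfl fun σ _ => ?_
  rw [← mul_assoc]
  congr 2
  have h : sigbar n ω σ = mixSpin (ω.2.2.1 (Fin.last n)) (ω.1 (Fin.last n)) σ := rfl
  rw [h, zfield, sfield, cavShift]
  have h2 : ∑ i, cavCoef n lam (mixSpin (ω.2.2.1 (Fin.last n)) (ω.1 (Fin.last n)) σ)
        (mix (fun i => ω.2.2.1 i.castSucc) (fun i => ω.1 i.castSucc) x) i * (cavProj n ω).2.2 i
      = mixSpin (ω.2.2.1 (Fin.last n)) (ω.1 (Fin.last n)) σ * (Real.sqrt (lam / n) *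
        ∑ i, mix (fun i => ω.2.2.1 i.castSucc) (fun i => ω.1 i.castSucc) x i
          * ω.2.1 (i.castSucc, Fin.last n)) := by
    simp only [Finset.mul_sum]
    refine Finset.sum_congr rfl fun i _ => ?_
    simp only [cavCoef, cavProj]
    ring
  rw [h2]
  ring

lemma integrable_log_mixExp_prod {Ω ι κ : Type*} [MeasurableSpace Ω] [Fintype ι]
    (ν : Measure Ω) [IsProbabilityMeasure ν] {T : Finset κ} {p α : Ω → κ → ℝ}
    {v : Ω → κ → ι → ℝ} (hpm : ∀ k, Measurable fun y => p y k)
    (hαm : ∀ k, Measurable fun y => α y k) (hvm : ∀ k i, Measurable fun y => v y k i)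
    (hp : ∀ y, ∀ k ∈ T, 0 ≤ p y k) (hp1 : ∀ y, ∑ k ∈ T, p y k = 1) {a B : ℝ}
    (hα : ∀ y, ∀ k ∈ T, |α y k| ≤ a) (hv : ∀ y, ∀ k ∈ T, ∀ i, |v y k i| ≤ B) :
    Integrable (fun z : Ω × (ι → ℝ) => Real.log (mixExp T (p z.1) (α z.1) (v z.1) z.2))
      (ν.prod (gaussPi ι)) := by
  refine ((integrable_sum_abs_gaussPi (ι := ι) a B).comp_snd ν).mono' ?_
    (Eventually.of_forall fun z => abs_log_mixExp_le (hp z.1) (hp1 z.1) (hα z.1) (hv z.1) z.2)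
  refine (Real.measurable_log.comp ?_).aestronglyMeasurable
  unfold mixExp
  refine Finset.measurable_fun_sum _ fun k _ => ((hpm k).comp measurable_fst).mul
    (Real.measurable_exp.comp (((hαm k).comp measurable_fst).add
      (Finset.measurable_fun_sum _ fun i _ => ((hvm k i).comp measurable_fst).mul
        ((measurable_pi_apply i).comp measurable_snd))))

lemma measurable_noisyObs (lam : ℝ) (X : Fin n → ℝ) : Measurable (noisyObs n lam X) :=
  measurable_id.add_const _

lemma measurable_gwt (lam : ℝ) (L : Fin n → Bool) (X x : Fin n → ℝ) :
    Measurable fun Y => gwt P0 S (obsLik n lam Y) L X x := by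
  unfold gwt gden
  exact ((measurable_obsLik lam _).const_mul _).div
    (Finset.measurable_fun_sum _ fun x _ => (measurable_obsLik lam _).const_mul _)

lemma abs_mixSpin_le {K : ℝ} (hSK : ∀ x ∈ S, |x| ≤ K) (l : Bool) {s σ : ℝ} (hs : s ∈ S)
    (hσ : σ ∈ S) : |mixSpin l s σ| ≤ K := by
  unfold mixSpin
  split_ifs
  exacts [hSK s hs, hSK σ hσ]

lemma abs_cavCoef_le {lam σ K : ℝ} {u : Fin n → ℝ} (hσ : |σ| ≤ K) (hu : ∀ i, |u i| ≤ K)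
    (i : Fin n) : |cavCoef n lam σ u i| ≤ K * Real.sqrt (lam / n) * K := by
  have hK : 0 ≤ K := (abs_nonneg _).trans hσ
  rw [cavCoef, abs_mul, abs_mul, abs_of_nonneg (Real.sqrt_nonneg _)]
  have := hu i
  gcongr

lemma integrable_log_cavU (hn : 0 < n) (hP : ∑ s ∈ S, (P0 {s}).toReal = 1) {lam K : ℝ}
    (hlam : 0 ≤ lam) (hSK : ∀ x ∈ S, |x| ≤ K) (L : Fin n → Bool) {X : Fin n → ℝ}
    (hX : X ∈ confs S n) (l : Bool) {s : ℝ} (hs : s ∈ S) :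
    Integrable (fun z : (Fin n × Fin n → ℝ) × (Fin n → ℝ) => Real.log
      (cavU P0 S lam (obsLik n lam (noisyObs n lam X z.1)) L X l s z.2))
      ((gaussPi (Fin n × Fin n)).prod (gaussPi (Fin n))) := by
  have hconf : ∀ x ∈ confs S n, ∀ i, |x i| ≤ K := fun x hx i =>
    hSK _ (Fintype.mem_piFinset.1 hx i)
  have hx : ∀ k ∈ confs S n ×ˢ S, ∀ i, |mix L X k.1 i| ≤ K := fun k hk =>
    hconf _ (mix_mem_confs L hX (Finset.mem_product.1 hk).1)
  have hσ : ∀ k ∈ confs S n ×ˢ S, |mixSpin l s k.2| ≤ K := fun k hk =>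
    abs_mixSpin_le hSK l hs (Finset.mem_product.1 hk).2
  unfold cavU
  exact integrable_log_mixExp_prod (gaussPi (Fin n × Fin n)) (T := confs S n ×ˢ S)
    (p := fun y k => gwt P0 S (obsLik n lam (noisyObs n lam X y)) L X k.1 * (P0 {k.2}).toReal)
    (α := fun _ k => cavShift n lam s (mixSpin l s k.2) (ndot n (mix L X k.1) X) (mix L X k.1))
    (v := fun _ k => cavCoef n lam (mixSpin l s k.2) (mix L X k.1))
    (a := 2 * lam * K ^ 4) (B := K * Real.sqrt (lam / n) * K)
    (fun k => ((measurable_gwt lam L X k.1).comp (measurable_noisyObs lam X)).mul_const _)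
    (fun k => measurable_const) (fun k i => measurable_const)
    (fun y => cav_weight_nonneg (obsLik_pos lam _) L X)
    (fun y => sum_cav_weight hP (obsLik_pos lam _) L X)
    (fun y k hk => abs_cavShift_le hn hlam (hSK s hs) (hσ k hk)
      (abs_ndot_le hn (hx k hk) (hconf X hX)) (hx k hk))
    (fun y k hk => abs_cavCoef_le (hσ k hk) (hx k hk))

lemma integrable_log_cavV (hn : 0 < n) (hP : ∑ s ∈ S, (P0 {s}).toReal = 1) {lam K : ℝ}
    (hlam : 0 ≤ lam) (hSK : ∀ x ∈ S, |x| ≤ K) (L : Fin n → Bool) {X : Fin n → ℝ}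
    (hX : X ∈ confs S n) (l : Bool) {s : ℝ} (hs : s ∈ S) :
    Integrable (fun z : (Fin n × Fin n → ℝ) × (Fin n → ℝ) => Real.log
      (cavV P0 S lam (obsLik n lam (noisyObs n lam X z.1)) L X l s z.2))
      ((gaussPi (Fin n × Fin n)).prod (gaussPi (Fin n))) := by
  have hσ : ∀ k ∈ confs S n ×ˢ S, |mixSpin l s k.2| ≤ K := fun k hk =>
    abs_mixSpin_le hSK l hs (Finset.mem_product.1 hk).2
  have hY := measurable_noisyObs lam X
  have hm : ∀ i, Measurable fun y => gmean P0 S (obsLik n lam (noisyObs n lam X y)) L X i :=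
    fun i => (measurable_gmean L X i).comp hY
  have hq : Measurable fun y => gQ P0 S (obsLik n lam (noisyObs n lam X y)) L X :=
    (measurable_gQ L X).comp hY
  have hb := fun y => abs_gmean_le hP (obsLik_pos lam (noisyObs n lam X y)) hSK L hX
  unfold cavV
  refine integrable_log_mixExp_prod (gaussPi (Fin n × Fin n)) (T := confs S n ×ˢ S)
    (p := fun y k => gwt P0 S (obsLik n lam (noisyObs n lam X y)) L X k.1 * (P0 {k.2}).toReal)
    (α := fun y k => cavShift n lam s (mixSpin l s k.2)
      (gQ P0 S (obsLik n lam (noisyObs n lam X y)) L X)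
      (gmean P0 S (obsLik n lam (noisyObs n lam X y)) L X))
    (v := fun y k => cavCoef n lam (mixSpin l s k.2)
      (gmean P0 S (obsLik n lam (noisyObs n lam X y)) L X))
    (a := 2 * lam * K ^ 4) (B := K * Real.sqrt (lam / n) * K)
    (fun k => ((measurable_gwt lam L X k.1).comp hY).mul_const _) (fun k => ?_) (fun k i => ?_)
    (fun y => cav_weight_nonneg (obsLik_pos lam _) L X)
    (fun y => sum_cav_weight hP (obsLik_pos lam _) L X)
    (fun y k hk => abs_cavShift_le hn hlam (hSK s hs) (hσ k hk)
      (abs_gQ_le hn hP (obsLik_pos lam _) hSK L hX) (hb y))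
    (fun y k hk => abs_cavCoef_le (hσ k hk) (hb y))
  · simp only [cavShift_gmean]
    fun_prop
  · exact (hm i).const_mul _

/-- Comparison of the two free energies, averaged over the noise. -/
lemma abs_integral_prod_log_cav_sub_le (hn : 0 < n) (hP : ∑ s ∈ S, (P0 {s}).toReal = 1)
    {lam K δ : ℝ} (hlam : 0 < lam) (hδ : 0 < δ) (hSK : ∀ x ∈ S, |x| ≤ K) (L : Fin n → Bool)
    {X : Fin n → ℝ} (hX : X ∈ confs S n) (l : Bool) {s : ℝ} (hs : s ∈ S) :
    |∫ z, Real.log (cavU P0 S lam (obsLik n lam (noisyObs n lam X z.1)) L X l s z.2)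
          ∂(gaussPi (Fin n × Fin n)).prod (gaussPi (Fin n))
        - ∫ z, Real.log (cavV P0 S lam (obsLik n lam (noisyObs n lam X z.1)) L X l s z.2)
          ∂(gaussPi (Fin n × Fin n)).prod (gaussPi (Fin n))|
      ≤ 1 / (2 * δ) * (Real.exp (3 * lam * K ^ 4) * (lam * K ^ 2 *
          ∫ Z, gfluct P0 S (obsLik n lam (noisyObs n lam X Z)) L X ∂gaussPi (Fin n × Fin n)))
        + 2 * δ * Real.exp (2 * (2 * lam * K ^ 4) + 2 * (lam * K ^ 4)) := by
  have hU := integrable_log_cavU hn hP hlam.le hSK L hX l hs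
  have hV := integrable_log_cavV hn hP hlam.le hSK L hX l hs
  rw [integral_prod _ hU, integral_prod _ hV,
    ← integral_sub hU.integral_prod_left hV.integral_prod_left]
  have hg : Integrable (fun Z => gfluct P0 S (obsLik n lam (noisyObs n lam X Z)) L X)
      (gaussPi (Fin n × Fin n)) :=
    Integrable.of_bound
      ((measurable_gfluct L X).comp (measurable_noisyObs lam X)).aestronglyMeasurable
      (14 * K ^ 2) (Eventually.of_forall fun Z =>
        abs_gfluct_le hn hP (obsLik_pos lam _) hSK L hX)
  have hb : Integrable (fun Z => 1 / (2 * δ) * (Real.exp (3 * lam * K ^ 4) * (lam * K ^ 2 *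
      gfluct P0 S (obsLik n lam (noisyObs n lam X Z)) L X))) (gaussPi (Fin n × Fin n)) :=
    ((hg.const_mul _).const_mul _).const_mul _
  have hc : Integrable (fun _ => 2 * δ * Real.exp (2 * (2 * lam * K ^ 4) + 2 * (lam * K ^ 4)))
      (gaussPi (Fin n × Fin n)) := integrable_const _
  refine abs_integral_le_integral_abs.trans ?_
  refine (integral_mono_of_nonneg (Eventually.of_forall fun _ => abs_nonneg _) (hb.add hc)
    (Eventually.of_forall fun Z => abs_integral_log_cav_sub_le hn hP
      (obsLik_pos lam (noisyObs n lam X Z)) hlam hδ hSK L hX l hs)).trans_eq ?_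
  rw [integral_add' hb hc, integral_const_mul, integral_const_mul, integral_const_mul]
  simp

end CavityComparison

section CavityGap

variable {n : ℕ} {P0 : Measure ℝ} [IsProbabilityMeasure P0] {S : Finset ℝ}

lemma sum_toReal_singleton (hsupp : P0 ((↑S : Set ℝ)ᶜ) = 0) :
    ∑ s ∈ S, (P0 {s}).toReal = 1 := by
  have h : P0 (S : Set ℝ) = 1 := (prob_compl_eq_zero_iff S.measurableSet).1 hsupp
  rw [← ENNReal.toReal_sum fun s _ => measure_ne_top _ _, sum_measure_singleton, h,
    ENNReal.toReal_one]

lemma integral_eq_sum_support (hsupp : P0 ((↑S : Set ℝ)ᶜ) = 0) (f : ℝ → ℝ) :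
    ∫ x, f x ∂P0 = ∑ s ∈ S, (P0 {s}).toReal * f s := by
  conv_lhs => rw [← Measure.restrict_eq_self_of_ae_mem
    (show ∀ᵐ x ∂P0, x ∈ (S : Set ℝ) from hsupp)]
  exact setIntegral_finset S IntegrableOn.finset

/-- The cavity gap at a fixed revelation probability is controlled by the overlap fluctuations. -/
lemma abs_cavity_gap_le (hsupp : P0 ((↑S : Set ℝ)ᶜ) = 0) (hn : 0 < n) {lam K δ ε : ℝ}
    (hlam : 0 < lam) (hδ : 0 < δ) (hSK : ∀ x ∈ S, |x| ≤ K) (h0 : 0 ≤ ε) (h1 : ε ≤ 1) :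
    |(∫ ω, Real.log (Ucav P0 S n lam ω) ∂cavMeas P0 n ε)
          - (ε * (∫ x, x ^ 2 ∂P0) * (lam / 2) *
              (∫ ω, Qoverlap P0 S n lam ω ∂cavMeas P0 n ε)
            + (1 - ε) * ∫ ω, scalarFree P0 S lam (Qoverlap P0 S n lam ω) (ω.1 (Fin.last n))
              ∂cavMeas P0 n ε)|
      ≤ 1 / (2 * δ) * (Real.exp (3 * lam * K ^ 4) * (lam * K ^ 2 *
          ∑ L : Fin n → Bool, bernWt ε L * fluctMean P0 S lam L))
        + 2 * δ * Real.exp (2 * (2 * lam * K ^ 4) + 2 * (lam * K ^ 4)) := by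
  have hP := sum_toReal_singleton hsupp
  set G := (gaussPi (Fin n × Fin n)).prod (gaussPi (Fin n)) with hG
  set e : (Fin n → ℝ) → (Fin n × Fin n → ℝ) → (Fin n → ℝ) → ℝ :=
    fun X Z => obsLik n lam (noisyObs n lam X Z) with he
  have hepos : ∀ X Z x, 0 < e X Z x := fun X Z => obsLik_pos lam _
  have hQm : ∀ X L, Measurable fun Z => gQ P0 S (e X Z) L X := fun X L =>
    (measurable_gQ L X).comp (measurable_noisyObs lam X)
  have hQi : ∀ X ∈ confs S n, ∀ L, Integrable (fun Z => gQ P0 S (e X Z) L X)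
      (gaussPi (Fin n × Fin n)) := fun X hX L =>
    Integrable.of_bound (hQm X L).aestronglyMeasurable (K ^ 2) (Eventually.of_forall fun Z =>
      abs_gQ_le hn hP (hepos X Z) hSK L hX)
  set U : (Fin n → ℝ) → (Fin n → Bool) → ℝ → Bool → ℝ := fun X L s l =>
    ∫ z, Real.log (cavU P0 S lam (e X z.1) L X l s z.2) ∂G with hU
  set V : (Fin n → ℝ) → (Fin n → Bool) → ℝ → Bool → ℝ := fun X L s l =>
    ∫ z, Real.log (cavV P0 S lam (e X z.1) L X l s z.2) ∂G with hV
  have hVi : ∀ X ∈ confs S n, ∀ L, ∀ s ∈ S, ∀ l,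
      Integrable (fun z => Real.log (cavV P0 S lam (e X z.1) L X l s z.2)) G :=
    fun X hX L s hs l => integrable_log_cavV hn hP hlam.le hSK L hX l hs
  have hFi : ∀ X ∈ confs S n, ∀ L, ∀ s ∈ S,
      Integrable (fun Z => scalarFree P0 S lam (gQ P0 S (e X Z) L X) s)
        (gaussPi (Fin n × Fin n)) := fun X hX L s hs =>
    (hVi X hX L s hs false).integral_prod_left.congr (Eventually.of_forall fun Z =>
      integral_log_cavV_false hn hP (hepos X Z) hlam.le L X s)
  have hVt : ∀ X ∈ confs S n, ∀ L, ∀ s ∈ S,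
      V X L s true = s ^ 2 * (lam / 2) * ∫ z, gQ P0 S (e X z.1) L X ∂G := by
    intro X hX L s hs
    refine (integral_prod _ (hVi X hX L s hs true)).trans ?_
    rw [integral_fun_fst (fun Z => gQ P0 S (e X Z) L X), probReal_univ, one_smul,
      ← integral_const_mul]
    exact integral_congr_ae (Eventually.of_forall fun Z =>
      integral_log_cavV_true hP (hepos X Z) _ _ _ _)
  have hVf : ∀ X ∈ confs S n, ∀ L, ∀ s ∈ S,
      V X L s false = ∫ z, scalarFree P0 S lam (gQ P0 S (e X z.1) L X) s ∂G := by
    intro X hX L s hs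
    refine (integral_prod _ (hVi X hX L s hs false)).trans ?_
    rw [integral_fun_fst (fun Z => scalarFree P0 S lam (gQ P0 S (e X Z) L X) s), probReal_univ,
      one_smul]
    exact integral_congr_ae (Eventually.of_forall fun Z =>
      integral_log_cavV_false hn hP (hepos X Z) hlam.le L X s)
  have t1 := integral_cavMeas P0 S hsupp n h0 h1
    (fun X L s l z => Real.log (cavU P0 S lam (e X z.1) L X l s z.2))
    (fun X hX L s hs l => integrable_log_cavU hn hP hlam.le hSK L hX l hs)
  have t2 := integral_cavMeas P0 S hsupp n h0 h1
    (fun X L s l z => gQ P0 S (e X z.1) L X)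
    (fun X hX L s hs l => (hQi X hX L).comp_fst _)
  have t3 := integral_cavMeas P0 S hsupp n h0 h1
    (fun X L s l z => scalarFree P0 S lam (gQ P0 S (e X z.1) L X) s)
    (fun X hX L s hs l => (hFi X hX L s hs).comp_fst _)
  simp only [Ucav_eq hlam.le, Qoverlap_eq hlam.le]
  rw [t1, t2, t3, integral_eq_sum_support hsupp]
  have key : (∑ X ∈ confs S n, weight P0 n X * ∑ s ∈ S, (P0 {s}).toReal * ∑ L, bernWt ε L *
        (ε * U X L s true + (1 - ε) * U X L s false))
      - (ε * (∑ s ∈ S, (P0 {s}).toReal * s ^ 2) * (lam / 2) *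
          (∑ X ∈ confs S n, weight P0 n X * ∑ s ∈ S, (P0 {s}).toReal * ∑ L, bernWt ε L *
            (ε * (∫ z, gQ P0 S (e X z.1) L X ∂G) + (1 - ε) * ∫ z, gQ P0 S (e X z.1) L X ∂G))
        + (1 - ε) * ∑ X ∈ confs S n, weight P0 n X * ∑ s ∈ S, (P0 {s}).toReal *
            ∑ L, bernWt ε L * (ε * (∫ z, scalarFree P0 S lam (gQ P0 S (e X z.1) L X) s ∂G)
              + (1 - ε) * ∫ z, scalarFree P0 S lam (gQ P0 S (e X z.1) L X) s ∂G))
      = ∑ X ∈ confs S n, weight P0 n X * ∑ s ∈ S, (P0 {s}).toReal * ∑ L, bernWt ε L *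
        (ε * (U X L s true - V X L s true) + (1 - ε) * (U X L s false - V X L s false)) := by
    have e2 : ε * (∑ s ∈ S, (P0 {s}).toReal * s ^ 2) * (lam / 2) *
          (∑ X ∈ confs S n, weight P0 n X * ∑ s ∈ S, (P0 {s}).toReal * ∑ L, bernWt ε L *
            (ε * (∫ z, gQ P0 S (e X z.1) L X ∂G) + (1 - ε) * ∫ z, gQ P0 S (e X z.1) L X ∂G))
        = ∑ X ∈ confs S n, weight P0 n X * ∑ s ∈ S, (P0 {s}).toReal * ∑ L, bernWt ε L *
            (ε * V X L s true) := by
      rw [Finset.mul_sum]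
      refine Finset.sum_congr rfl fun X hX => ?_
      set R := ∑ L, bernWt ε L * ∫ z, gQ P0 S (e X z.1) L X ∂G with hR
      have r1 : ∑ s ∈ S, (P0 {s}).toReal * ∑ L, bernWt ε L *
          (ε * (∫ z, gQ P0 S (e X z.1) L X ∂G) + (1 - ε) * ∫ z, gQ P0 S (e X z.1) L X ∂G)
          = R := by
        rw [← Finset.sum_mul, hP, one_mul]
        exact Finset.sum_congr rfl fun L _ => by ring
      have r2 : ∀ s ∈ S, ∑ L, bernWt ε L * (ε * V X L s true) = ε * (s ^ 2 * (lam / 2)) * R := by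
        intro s hs
        rw [hR, Finset.mul_sum]
        refine Finset.sum_congr rfl fun L _ => ?_
        rw [hVt X hX L s hs]
        ring
      rw [r1, Finset.sum_congr rfl fun s hs => congrArg _ (r2 s hs)]
      simp only [Finset.mul_sum, Finset.sum_mul]
      exact Finset.sum_congr rfl fun s _ => by ring
    have e3 : (1 - ε) * (∑ X ∈ confs S n, weight P0 n X * ∑ s ∈ S, (P0 {s}).toReal *
            ∑ L, bernWt ε L * (ε * (∫ z, scalarFree P0 S lam (gQ P0 S (e X z.1) L X) s ∂G)
              + (1 - ε) * ∫ z, scalarFree P0 S lam (gQ P0 S (e X z.1) L X) s ∂G))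
        = ∑ X ∈ confs S n, weight P0 n X * ∑ s ∈ S, (P0 {s}).toReal * ∑ L, bernWt ε L *
            ((1 - ε) * V X L s false) := by
      simp only [Finset.mul_sum]
      refine Finset.sum_congr rfl fun X hX => Finset.sum_congr rfl fun s hs =>
        Finset.sum_congr rfl fun L _ => ?_
      rw [hVf X hX L s hs]
      ring
    rw [e2, e3, ← Finset.sum_add_distrib, ← Finset.sum_sub_distrib]
    simp only [Finset.mul_sum, ← Finset.sum_add_distrib, ← Finset.sum_sub_distrib]
    refine Finset.sum_congr rfl fun X hX => Finset.sum_congr rfl fun s hs =>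
        Finset.sum_congr rfl fun L _ => ?_
    ring
  rw [key]
  set A := 1 / (2 * δ) * (Real.exp (3 * lam * K ^ 4) * (lam * K ^ 2)) with hA
  set B := 2 * δ * Real.exp (2 * (2 * lam * K ^ 4) + 2 * (lam * K ^ 4)) with hB
  set g : (Fin n → ℝ) → (Fin n → Bool) → ℝ := fun X L =>
    ∫ Z, gfluct P0 S (e X Z) L X ∂gaussPi (Fin n × Fin n) with hg
  have hUV : ∀ X ∈ confs S n, ∀ L, ∀ s ∈ S, ∀ l, |U X L s l - V X L s l| ≤ A * g X L + B := by
    intro X hX L s hs l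
    refine (abs_integral_prod_log_cav_sub_le hn hP hlam hδ hSK L hX l hs).trans_eq ?_
    rw [hA, hg]
    ring
  have hw : ∀ X, 0 ≤ weight P0 n X := weight_nonneg P0
  have hb := bernWt_nonneg (n := n) h0 h1
  have h1' : 0 ≤ 1 - ε := by linarith
  calc _ ≤ ∑ X ∈ confs S n, weight P0 n X * ∑ s ∈ S, (P0 {s}).toReal * ∑ L, bernWt ε L *
        (A * g X L + B) := by
        refine (Finset.abs_sum_le_sum_abs _ _).trans (Finset.sum_le_sum fun X hX => ?_)
        rw [abs_mul, abs_of_nonneg (hw X)]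
        refine mul_le_mul_of_nonneg_left ?_ (hw X)
        refine (Finset.abs_sum_le_sum_abs _ _).trans (Finset.sum_le_sum fun s hs => ?_)
        rw [abs_mul, abs_of_nonneg ENNReal.toReal_nonneg]
        refine mul_le_mul_of_nonneg_left ?_ ENNReal.toReal_nonneg
        refine (Finset.abs_sum_le_sum_abs _ _).trans (Finset.sum_le_sum fun L _ => ?_)
        rw [abs_mul, abs_of_nonneg (hb L)]
        refine mul_le_mul_of_nonneg_left ?_ (hb L)
        refine (abs_add_le _ _).trans ?_
        rw [abs_mul, abs_mul, abs_of_nonneg h0, abs_of_nonneg h1']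
        have a1 := mul_le_mul_of_nonneg_left (hUV X hX L s hs true) h0
        have a2 := mul_le_mul_of_nonneg_left (hUV X hX L s hs false) h1'
        linarith
    _ = _ := by
        have hbs := sum_bernWt n ε
        have hws := sum_weight (S := S) hP n
        simp only [mul_add, Finset.sum_add_distrib, ← Finset.sum_mul, hP, hbs, hws, one_mul]
        congr 1
        rw [← mul_assoc (Real.exp _), ← mul_assoc (1 / (2 * δ)), ← hA]
        simp only [fluctMean, Finset.mul_sum]
        rw [Finset.sum_comm]
        refine Finset.sum_congr rfl fun L _ => Finset.sum_congr rfl fun X _ => ?_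
        rw [hg]
        ring

end CavityGap

section Averaging

variable {n : ℕ} {P0 : Measure ℝ} {S : Finset ℝ}

/-- Derivative of the expected energy with respect to the revelation probability. -/
def energyDeriv (P0 : Measure ℝ) (S : Finset ℝ) (n : ℕ) (lam ε : ℝ) : ℝ :=
  ∑ j, ∑ L : Fin n → Bool, bernWt ε L *
    (meanEnergy P0 S lam (Function.update L j true)
      - meanEnergy P0 S lam (Function.update L j false))

lemma continuous_energyDeriv (lam : ℝ) : Continuous (energyDeriv P0 S n lam) :=
  continuous_finsetSum _ fun _ _ => continuous_finsetSum _ fun L _ =>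
    (continuous_bernWt L).mul continuous_const

lemma integral_energyDeriv_le (hP : ∑ s ∈ S, (P0 {s}).toReal = 1) {lam K : ℝ} (hlam : 0 ≤ lam)
    (hSK : ∀ x ∈ S, |x| ≤ K) {ε₀ : ℝ} (h0 : 0 ≤ ε₀) (h1 : ε₀ ≤ 1) :
    ∫ ε in (0 : ℝ)..ε₀, energyDeriv P0 S n lam ε ≤ n * K ^ 2 := by
  rw [intervalIntegral.integral_eq_sub_of_hasDerivAt (f' := energyDeriv P0 S n lam)
    (fun ε _ => hasDerivAt_sum_bernWt (meanEnergy P0 S lam) ε)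
    ((continuous_energyDeriv lam).intervalIntegrable _ _)]
  have a : ∑ L : Fin n → Bool, bernWt ε₀ L * meanEnergy P0 S lam L ≤ n * K ^ 2 := by
    calc _ ≤ ∑ L : Fin n → Bool, bernWt ε₀ L * (n * K ^ 2) :=
          Finset.sum_le_sum fun L _ => mul_le_mul_of_nonneg_left
            (meanEnergy_le hP hlam hSK L) (bernWt_nonneg h0 h1 L)
      _ = n * K ^ 2 := by rw [← Finset.sum_mul, sum_bernWt, one_mul]
  have b : 0 ≤ ∑ L : Fin n → Bool, bernWt 0 L * meanEnergy P0 S lam L :=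
    Finset.sum_nonneg fun L _ =>
      mul_nonneg (bernWt_nonneg le_rfl zero_le_one L) (meanEnergy_nonneg lam L)
  linarith

lemma sum_bernWt_fluctMean_le (hn : 0 < n) (hP : ∑ s ∈ S, (P0 {s}).toReal = 1) {lam K : ℝ}
    (hlam : 0 ≤ lam) (hK : 0 < K) (hSK : ∀ x ∈ S, |x| ≤ K) {η ζ ε : ℝ} (hη : 0 < η) (hζ : 0 < ζ)
    (h0 : 0 ≤ ε) (h1 : ε ≤ 1) :
    ∑ L : Fin n → Bool, bernWt ε L * fluctMean P0 S lam L
      ≤ 7 / 2 * (η + K ^ 2 / η * (ζ + 1 / ζ * (1 / n : ℝ) ^ 2 *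
        (K ^ 2 * energyDeriv P0 S n lam ε))) := by
  have hpin : ∑ L : Fin n → Bool, bernWt ε L * ∑ j, covEnergy P0 S lam j L
      ≤ K ^ 2 * energyDeriv P0 S n lam ε :=
    pinning (fun j L => covEnergy P0 S lam j L) (meanEnergy P0 S lam) (pow_pos hK 2)
      (fun j L => covEnergy_nonneg lam j L) (fun j L => covEnergy_le hP hlam hSK j L) h0 h1
  calc _ ≤ ∑ L : Fin n → Bool, bernWt ε L * (7 / 2 * (η + K ^ 2 / η * (ζ + 1 / ζ *
          (1 / n : ℝ) ^ 2 * ∑ j, covEnergy P0 S lam j L))) :=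
        Finset.sum_le_sum fun L _ => mul_le_mul_of_nonneg_left
          (fluctMean_le hP hlam hSK hη hζ hn L) (bernWt_nonneg h0 h1 L)
    _ = 7 / 2 * (η + K ^ 2 / η * (ζ + 1 / ζ * (1 / n : ℝ) ^ 2 *
          ∑ L : Fin n → Bool, bernWt ε L * ∑ j, covEnergy P0 S lam j L)) := by
        have e : ∀ L : Fin n → Bool, bernWt ε L * (7 / 2 * (η + K ^ 2 / η * (ζ + 1 / ζ *
            (1 / n : ℝ) ^ 2 * ∑ j, covEnergy P0 S lam j L)))
            = bernWt ε L * (7 / 2 * (η + K ^ 2 / η * ζ)) + 7 / 2 * (K ^ 2 / η * (1 / ζ *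
              (1 / n : ℝ) ^ 2)) * (bernWt ε L * ∑ j, covEnergy P0 S lam j L) := fun L => by ring
        simp only [e]
        rw [Finset.sum_add_distrib, ← Finset.sum_mul, ← Finset.mul_sum, sum_bernWt]
        ring
    _ ≤ _ := by gcongr

/-- Quantitative form of the averaged cavity estimate. -/
lemma integral_abs_cavity_gap_le [IsProbabilityMeasure P0] (hsupp : P0 ((↑S : Set ℝ)ᶜ) = 0) (hn : 0 < n) {lam K r ε₀ : ℝ}
    (hlam : 0 < lam) (hK : 0 < K) (hSK : ∀ x ∈ S, |x| ≤ K) (hr : 0 < r) (hrn : r ^ 8 = 1 / n)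
    (h0 : 0 ≤ ε₀) (h1 : ε₀ ≤ 1) :
    ∫ ε in (0 : ℝ)..ε₀, |(∫ ω, Real.log (Ucav P0 S n lam ω) ∂cavMeas P0 n ε)
          - (ε * (∫ x, x ^ 2 ∂P0) * (lam / 2) *
              (∫ ω, Qoverlap P0 S n lam ω ∂cavMeas P0 n ε)
            + (1 - ε) * ∫ ω, scalarFree P0 S lam (Qoverlap P0 S n lam ω) (ω.1 (Fin.last n))
              ∂cavMeas P0 n ε)|
      ≤ (1 / 2 * (Real.exp (3 * lam * K ^ 4) * (lam * K ^ 2 *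
            (7 / 2 * (1 + K ^ 2 * (1 + K ^ 4)))))
          + 2 * Real.exp (2 * (2 * lam * K ^ 4) + 2 * (lam * K ^ 4))) * r := by
  have hP := sum_toReal_singleton hsupp
  have hn' : (0 : ℝ) < n := Nat.cast_pos.2 hn
  set c := Real.exp (3 * lam * K ^ 4) * (lam * K ^ 2) with hc
  have hc0 : 0 ≤ c := by positivity
  set B := 2 * Real.exp (2 * (2 * lam * K ^ 4) + 2 * (lam * K ^ 4)) with hB
  set a := 1 / (2 * r) * c * (7 / 2 * (r ^ 2 + K ^ 2 / r ^ 2 * r ^ 4)) + B * r with ha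
  set b := 1 / (2 * r) * c * (7 / 2 * (K ^ 2 / r ^ 2 * (1 / r ^ 4 * (1 / n : ℝ) ^ 2 * K ^ 2)))
    with hb
  have hb0 : 0 ≤ b := by positivity
  have ha0 : 0 ≤ a := by positivity
  have hint := ((continuous_energyDeriv (P0 := P0) (S := S) (n := n) lam).const_mul b).const_add a
  calc _ ≤ ∫ ε in (0 : ℝ)..ε₀, (a + b * energyDeriv P0 S n lam ε) := by
        rw [intervalIntegral.integral_of_le h0, intervalIntegral.integral_of_le h0]
        refine integral_mono_of_nonneg (Eventually.of_forall fun ε => abs_nonneg _)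
          ((intervalIntegrable_iff_integrableOn_Ioc_of_le h0).1 (hint.intervalIntegrable _ _)) ?_
        filter_upwards [ae_restrict_mem measurableSet_Ioc] with ε hε
        have hε1 := hε.2.trans h1
        refine (abs_cavity_gap_le hsupp hn hlam hr hSK hε.1.le hε1).trans ?_
        have := mul_le_mul_of_nonneg_left (sum_bernWt_fluctMean_le (P0 := P0) (S := S) hn hP
          hlam.le hK hSK (pow_pos hr 2) (pow_pos hr 4) hε.1.le hε1)
          (show 0 ≤ 1 / (2 * r) * c by positivity)
        rw [ha, hb, hB]
        rw [hc] at this ⊢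
        linarith
    _ = a * ε₀ + b * ∫ ε in (0 : ℝ)..ε₀, energyDeriv P0 S n lam ε := by
        rw [intervalIntegral.integral_add intervalIntegrable_const
          (((continuous_energyDeriv lam).const_mul b).intervalIntegrable _ _),
          intervalIntegral.integral_const_mul, intervalIntegral.integral_const, smul_eq_mul,
          sub_zero, mul_comm]
    _ ≤ a + b * (n * K ^ 2) := add_le_add (mul_le_of_le_one_right ha0 h1)
        (mul_le_mul_of_nonneg_left (integral_energyDeriv_le hP hlam.le hSK h0 h1) hb0)
    _ = _ := by
        have hs : (1 / n : ℝ) ^ 2 * n = r ^ 8 := by rw [hrn]; field_simp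
        have hb' : b * (n * K ^ 2) = 1 / (2 * r) * c * (7 / 2 * (K ^ 2 / r ^ 2 *
            (1 / r ^ 4 * r ^ 8 * K ^ 4))) := by
          rw [hb, ← hs]
          ring
        rw [hb', ha, hc]
        field_simp
        ring

end Averaging

/-- **Cavity estimate, first part**:
`∫_0^{ε₀} |E[log⟨Σ_σ P0(σ) exp(σ̄ z(x) + σ̄² s(x))⟩]
  − (ε E_{P0}[X²] (λ/2) E[Q]
     + (1−ε) E[log Σ_σ P0(σ) exp(√(λQ) σ Z₀ + λQ σ X′ − (λσ²/2) Q)])| dε → 0`,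
where `Z₀ ~ N(0,1)` is independent of all other random variables. -/
theorem cavity_estimate_part1 (P0 : Measure ℝ) [IsProbabilityMeasure P0]
    (S : Finset ℝ) (K : ℝ) (hK : 0 < K) (hSK : ∀ x ∈ S, x ∈ Set.Icc (-K) K)
    (hsupp : P0 ((↑S : Set ℝ)ᶜ) = 0) (lam : ℝ) (hlam : 0 < lam)
    (ε₀ : ℝ) (hε₀ : ε₀ ∈ Set.Ioc (0 : ℝ) 1) :
    Tendsto (fun n => ∫ ε in (0 : ℝ)..ε₀,
        |(∫ ω, Real.log (Ucav P0 S n lam ω) ∂cavMeas P0 n ε)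
          - (ε * (∫ x, x ^ 2 ∂P0) * (lam / 2) *
              (∫ ω, Qoverlap P0 S n lam ω ∂cavMeas P0 n ε)
            + (1 - ε) * ∫ ω, (∫ z0,
                Real.log (∑ σ ∈ S, (P0 {σ}).toReal *
                  Real.exp (Real.sqrt (lam * Qoverlap P0 S n lam ω) * σ * z0
                    + lam * Qoverlap P0 S n lam ω * σ * ω.1 (Fin.last n)
                    - lam * σ ^ 2 / 2 * Qoverlap P0 S n lam ω))
              ∂stdGauss) ∂cavMeas P0 n ε)|)
      atTop (nhds 0) := by
  have hSK' : ∀ x ∈ S, |x| ≤ K := fun x hx => abs_le.2 (hSK x hx)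
  have hlim : Tendsto (fun n : ℕ => (1 / n : ℝ) ^ (1 / 8 : ℝ)) atTop (nhds 0) := by
    have h := (tendsto_one_div_atTop_nhds_zero_nat (𝕜 := ℝ)).rpow_const
      (p := (1 / 8 : ℝ)) (Or.inr (by norm_num))
    rwa [Real.zero_rpow (by norm_num)] at h
  have hlim' := hlim.const_mul (1 / 2 * (Real.exp (3 * lam * K ^ 4) * (lam * K ^ 2 *
      (7 / 2 * (1 + K ^ 2 * (1 + K ^ 4)))))
    + 2 * Real.exp (2 * (2 * lam * K ^ 4) + 2 * (lam * K ^ 4)))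
  rw [mul_zero] at hlim'
  refine tendsto_of_tendsto_of_tendsto_of_le_of_le' tendsto_const_nhds hlim'
    (Eventually.of_forall fun n => intervalIntegral.integral_nonneg hε₀.1.le
      fun _ _ => abs_nonneg _) ?_
  filter_upwards [eventually_gt_atTop 0] with n hn
  have hn' : (0 : ℝ) < 1 / n := one_div_pos.2 (Nat.cast_pos.2 hn)
  refine integral_abs_cavity_gap_le hsupp hn hlam hK hSK' (Real.rpow_pos_of_pos hn' _) ?_
    hε₀.1.le hε₀.2
  rw [← Real.rpow_natCast, ← Real.rpow_mul hn'.le]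
  norm_num

end
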